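/- For every odd prime q and ε ∈ (0,1) there exists a constant C_{ε,q} such that the following holds. Fix an integer A with 1/ε ≤ A ≤ 2/ε; let R = q^{2m} (m ∈ ℕ) be sufficiently large, let r ∈ 4ℕ satisfy q^{q^{A(r−4)}} ≤ R < q^{q^{Ar}}, set R_k := q^{kr}, and let N ∈ ℕ satisfy q^{Nr} ≤ R < q^{(N+1)r}. Let J ∈ {1,…,N}, let f : ℚ_q² → ℂ be Schwartz with Fourier support in Ξ_{1/R_J}, let k ∈ {0,1,…,J−1}, and let τ_k ⊂ ℤ_q be an interval of length R_k^{-1/2}. Define B_{τ_k} := {x ∈ ℚ_q² : |f_{τ_k}(x)| ≤ (log R) q^{r/2} M_k(x) and (∑_{τ_{k+1} ⊂ τ_k} |f_{τ_{k+1}}(x)|⁶)^{1/6} ≤ (log R) q^{r/2} M_k(x)}, where M_k(x) := max_{τ_{k+1} ≠ τ'_{k+1}, τ_{k+1},τ'_{k+1} ⊂ τ_k} |f_{τ_{k+1}}(x) f_{τ'_{k+1}}(x)|^{1/2}. Then ∫_{B_{τ_k}} max_{τ_{k+1} ≠ τ'_{k+1}, τ_{k+1},τ'_{k+1} ⊂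 τ_k} |f_{τ_{k+1}} f_{τ'_{k+1}}|³ dμ² ≤ C_{ε,q} (log R)^{8+7ε/2} (∑_{τ_J ⊂ τ_k} ‖f_{τ_J}‖_{L∞(ℚ_q²)}²)² (∑_{τ_J ⊂ τ_k} ∫_{ℚ_q²} |f_{τ_J}|² dμ²). -/

import Mathlib

open MeasureTheory

noncomputable instance (q : ℕ) [Fact q.Prime] : MeasurableSpace ℚ_[q] := borel _
instance (q : ℕ) [Fact q.Prime] : BorelSpace ℚ_[q] := ⟨rfl⟩

/-- The Fourier transform on `ℚ_q²` with respect to the additive character `χ`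
and the Haar measure `μ`. -/
noncomputable def qpFourier (q : ℕ) [Fact q.Prime] (μ : Measure ℚ_[q]) [SigmaFinite μ]
    (χ : ℚ_[q] → ℂ) (F : ℚ_[q] × ℚ_[q] → ℂ) (ξη : ℚ_[q] × ℚ_[q]) : ℂ :=
  ∫ x, F x * χ (-(ξη.1 * x.1 + ξη.2 * x.2)) ∂(μ.prod μ)

/-- The Fourier projection `F_τ` of `F` to the frequency strip `τ × ℚ_q`. -/
noncomputable def qpProj (q : ℕ) [Fact q.Prime] (μ : Measure ℚ_[q]) [SigmaFinite μ]
    (χ : ℚ_[q] → ℂ) (F : ℚ_[q] × ℚ_[q] → ℂ) (τ : Set ℚ_[q]) (x : ℚ_[q] × ℚ_[q]) : ℂ :=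
  ∫ ξη in τ ×ˢ (Set.univ : Set ℚ_[q]),
    qpFourier q μ χ F ξη * χ (ξη.1 * x.1 + ξη.2 * x.2) ∂(μ.prod μ)

/-- The interval `{ξ ∈ ℤ_q : |ξ - a| ≤ q^{-ℓ}}`; as `a` runs over `0, …, q^ℓ - 1` these
enumerate all intervals of length `q^{-ℓ}` inside `ℤ_q`. -/
def qpItv (q : ℕ) [Fact q.Prime] (ℓ a : ℕ) : Set ℚ_[q] :=
  {ξ : ℚ_[q] | ‖ξ - (a : ℚ_[q])‖ ≤ (q : ℝ) ^ (-(ℓ : ℤ))}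

open scoped Classical in
/-- Indices `b < q^{ℓ'}` whose associated interval of length `q^{-ℓ'}` is contained in the
interval `qpItv q ℓ a` (equivalently, whose centre lies in it). -/
noncomputable def qpSubItv (q : ℕ) [Fact q.Prime] (ℓ' ℓ a : ℕ) : Finset ℕ :=
  (Finset.range (q ^ ℓ')).filter (fun b => (b : ℚ_[q]) ∈ qpItv q ℓ a)

/-- `max_{τ' ≠ τ'' ⊂ τ} |f_{τ'}(x) f_{τ''}(x)|^{1/2}`, the maximum being over distinct
intervals of length `q^{-ℓ'}` contained in the interval `qpItv q ℓ a`. -/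
noncomputable def qpMaxPair (q : ℕ) [Fact q.Prime] (μ : Measure ℚ_[q]) [SigmaFinite μ]
    (χ : ℚ_[q] → ℂ) (f : ℚ_[q] × ℚ_[q] → ℂ) (ℓ' ℓ a : ℕ) (x : ℚ_[q] × ℚ_[q]) : ℝ :=
  ⨆ b ∈ qpSubItv q ℓ' ℓ a, ⨆ b' ∈ qpSubItv q ℓ' ℓ a, ⨆ _ : b ≠ b',
    Real.sqrt ‖qpProj q μ χ f (qpItv q ℓ' b) x * qpProj q μ χ f (qpItv q ℓ' b') x‖


open MeasureTheory

section GenericLemmas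

/-- Almost orthogonality with blocks. -/
theorem block_orth {X ι κ : Type*} [Fintype X] [DecidableEq κ] (S : Finset ι) (π : ι → κ)
    (u : ι → X → ℂ) (K : ℝ)
    (hK : ∀ i ∈ S, ((S.filter (fun j => π j = π i)).card : ℝ) ≤ K)
    (ho : ∀ i ∈ S, ∀ j ∈ S, π i ≠ π j → ∑ x, u i x * starRingEnd ℂ (u j x) = 0) :
    ∑ x, ‖∑ i ∈ S, u i x‖ ^ 2 ≤ K * ∑ i ∈ S, ∑ x, ‖u i x‖ ^ 2 := by
  have h1 : ((∑ x, ‖∑ i ∈ S, u i x‖ ^ 2 : ℝ) : ℂ)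
      = ∑ i ∈ S, ∑ j ∈ S, ∑ x, u i x * starRingEnd ℂ (u j x) := by
    push_cast
    calc ∑ x, ((‖∑ i ∈ S, u i x‖ : ℝ) : ℂ) ^ 2
        = ∑ x, ∑ i ∈ S, ∑ j ∈ S, u i x * starRingEnd ℂ (u j x) := by
          refine Finset.sum_congr rfl fun x _ => ?_
          rw [← Complex.mul_conj', map_sum, Finset.sum_mul_sum]
      _ = _ := by
          rw [Finset.sum_comm]
          refine Finset.sum_congr rfl fun i _ => ?_
          rw [Finset.sum_comm]
  have h2 : ∑ x, ‖∑ i ∈ S, u i x‖ ^ 2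
      = ∑ i ∈ S, ∑ j ∈ S, (∑ x, u i x * starRingEnd ℂ (u j x)).re := by
    have := congrArg Complex.re h1
    rw [Complex.ofReal_re] at this
    rw [this, Complex.re_sum]
    refine Finset.sum_congr rfl fun i _ => ?_
    rw [Complex.re_sum]
  set n : ι → ℝ := fun i => ∑ x, ‖u i x‖ ^ 2 with hn
  have hn0 : ∀ i, 0 ≤ n i := fun i => Finset.sum_nonneg fun x _ => by positivity
  have h3 : ∀ i ∈ S, ∀ j ∈ S, (∑ x, u i x * starRingEnd ℂ (u j x)).re
      ≤ if π j = π i then (n i + n j) / 2 else 0 := by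
    intro i hi j hj
    split_ifs with h
    · rw [Complex.re_sum]
      have : (n i + n j) / 2 = ∑ x, (‖u i x‖ ^ 2 + ‖u j x‖ ^ 2) / 2 := by
        rw [← Finset.sum_div, Finset.sum_add_distrib]
      rw [this]
      refine Finset.sum_le_sum fun x _ => ?_
      refine (Complex.re_le_norm _).trans ?_
      rw [norm_mul, RCLike.norm_conj]
      nlinarith [sq_nonneg (‖u i x‖ - ‖u j x‖)]
    · rw [ho i hi j hj (fun h' => h h'.symm)]; simp
  rw [h2]
  calc ∑ i ∈ S, ∑ j ∈ S, (∑ x, u i x * starRingEnd ℂ (u j x)).re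
      ≤ ∑ i ∈ S, ∑ j ∈ S, (if π j = π i then (n i + n j) / 2 else 0) :=
        Finset.sum_le_sum fun i hi => Finset.sum_le_sum fun j hj => h3 i hi j hj
    _ = ∑ i ∈ S, ∑ j ∈ S, (if π j = π i then n i / 2 else 0)
        + ∑ i ∈ S, ∑ j ∈ S, (if π j = π i then n j / 2 else 0) := by
        rw [← Finset.sum_add_distrib]
        refine Finset.sum_congr rfl fun i _ => ?_
        rw [← Finset.sum_add_distrib]
        refine Finset.sum_congr rfl fun j _ => ?_
        split_ifs <;> ring
    _ = ∑ i ∈ S, ∑ j ∈ S, (if π j = π i then n i / 2 else 0)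
        + ∑ i ∈ S, ∑ j ∈ S, (if π j = π i then n i / 2 else 0) := by
        congr 1
        rw [Finset.sum_comm]
        refine Finset.sum_congr rfl fun i _ => Finset.sum_congr rfl fun j _ => ?_
        simp only [eq_comm]
    _ = ∑ i ∈ S, ((S.filter (fun j => π j = π i)).card : ℝ) * n i := by
        rw [← Finset.sum_add_distrib]
        refine Finset.sum_congr rfl fun i _ => ?_
        rw [← Finset.sum_filter, Finset.sum_const, nsmul_eq_mul]; ring
    _ ≤ ∑ i ∈ S, K * n i :=
        Finset.sum_le_sum fun i hi => mul_le_mul_of_nonneg_right (hK i hi) (hn0 i)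
    _ = _ := by rw [Finset.mul_sum]

variable {V : Type*} [AddCommGroup V] [Fintype V]

/-- Average over a subgroup. -/
noncomputable def av (H : AddSubgroup V) [Fintype H] (g : V → ℝ) (v : V) : ℝ :=
  (∑ t : H, g (v + t)) / (Fintype.card H : ℝ)

theorem card_pos' (H : AddSubgroup V) [Fintype H] : (0 : ℝ) < (Fintype.card H : ℝ) := by
  exact_mod_cast Fintype.card_pos

theorem av_nonneg (H : AddSubgroup V) [Fintype H] (g : V → ℝ) (hg : ∀ v, 0 ≤ g v) (v : V) :
    0 ≤ av H g v :=
  div_nonneg (Finset.sum_nonneg fun t _ => hg _) (card_pos' H).le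

theorem av_le (H : AddSubgroup V) [Fintype H] (g : V → ℝ) (B : ℝ) (hg : ∀ v, g v ≤ B) (v : V) :
    av H g v ≤ B := by
  unfold av
  rw [div_le_iff₀ (card_pos' H)]
  calc ∑ t : H, g (v + t) ≤ ∑ t : H, B := Finset.sum_le_sum fun t _ => hg _
    _ = _ := by simp [mul_comm]

theorem av_inv (H : AddSubgroup V) [Fintype H] (g : V → ℝ) (v : V) (h : V) (hh : h ∈ H) :
    av H g (v + h) = av H g v := by
  unfold av
  congr 1
  refine Fintype.sum_equiv (Equiv.addLeft (⟨h, hh⟩ : H)) _ _ fun t => ?_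
  simp [add_assoc]

theorem av_sum_comm {ι : Type*} (H : AddSubgroup V) [Fintype H] (S : Finset ι) (g : ι → V → ℝ)
    (v : V) : av H (fun v => ∑ i ∈ S, g i v) v = ∑ i ∈ S, av H (g i) v := by
  unfold av
  rw [Finset.sum_comm, Finset.sum_div]

open Classical in
theorem sum_av (H : AddSubgroup V) [Fintype H] (p : V → Prop)
    (hp : ∀ v, ∀ h ∈ H, p (v + h) → p v) (g : V → ℝ) :
    ∑ x with p x, g x = ∑ x with p x, av H g x := by
  have hp' : ∀ v, ∀ h ∈ H, (p (v + h) ↔ p v) := fun v h hh =>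
    ⟨hp v h hh, fun hv => hp (v + h) (-h) (H.neg_mem hh) (by simpa using hv)⟩
  have key : ∀ t : H, ∑ x with p x, g (x + t) = ∑ x with p x, g x := by
    intro t
    rw [Finset.sum_filter, Finset.sum_filter]
    refine Fintype.sum_equiv (Equiv.addRight (t : V)) _ _ fun x => ?_
    simp only [Equiv.coe_addRight, hp' x t t.2]
  unfold av
  rw [← Finset.sum_div, Finset.sum_comm]
  simp only [key]
  rw [Finset.sum_const, nsmul_eq_mul, Finset.card_univ, mul_div_assoc, mul_comm,
    div_mul_cancel₀ _ (card_pos' H).ne']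

theorem sum_av_univ (H : AddSubgroup V) [Fintype H] (g : V → ℝ) :
    ∑ x, g x = ∑ x, av H g x := by
  have := sum_av H (fun _ => True) (fun _ _ _ _ => trivial) g
  simpa using this

/-- orthogonality of high parts -/
theorem high_orth (H : AddSubgroup V) [Fintype H] (T T' : Set V)
    (hT : ∀ h ∈ H, ∃ t ∈ T, ∃ t' ∈ T', h = t + t')
    (w w' : V → ℝ) (hw : ∀ v, ∀ t ∈ T, w (v + t) = w v) (hw' : ∀ v, ∀ t ∈ T', w' (v + t) = w' v)
    (hz : ∀ v, ∑ h : H, w (v + h) = 0) :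
    ∑ x, w x * w' x = 0 := by
  have key : ∀ h : H, ∑ x, w x * w' x = ∑ x, w (x + h) * w' x := by
    intro h
    obtain ⟨t, ht, t', ht', e⟩ := hT h h.2
    rw [← Equiv.sum_comp (Equiv.addRight t') (fun x => w x * w' x)]
    refine Finset.sum_congr rfl fun x _ => ?_
    simp only [Equiv.coe_addRight]
    rw [hw' x t' ht', e, show x + (t + t') = (x + t') + t by abel, hw _ t ht]
  have h2 : (Fintype.card H : ℝ) * ∑ x, w x * w' x = 0 := by
    calc (Fintype.card H : ℝ) * ∑ x, w x * w' x = ∑ h : H, ∑ x, w x * w' x := by simp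
      _ = ∑ h : H, ∑ x, w (x + h) * w' x := Finset.sum_congr rfl fun h _ => key h
      _ = ∑ x, (∑ h : H, w (x + h)) * w' x := by
          rw [Finset.sum_comm]
          exact Finset.sum_congr rfl fun x _ => (Finset.sum_mul _ _ _).symm
      _ = 0 := by simp [hz]
  exact (mul_eq_zero.mp h2).resolve_left (card_pos' H).ne'

/-- Averaging the square of a sum of equivariant functions. -/
theorem av_sq_le {ι κ : Type*} [DecidableEq κ] (H : AddSubgroup V) [Fintype H]
    (S : Finset ι) (π : ι → κ) (K : ℝ)
    (hK : ∀ i ∈ S, ((S.filter (fun j => π j = π i)).card : ℝ) ≤ K)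
    (θ : ι → AddChar V ℂ)
    (hθ : ∀ i ∈ S, ∀ j ∈ S, (∀ h ∈ H, θ i h = θ j h) → π i = π j)
    (P : ι → V → ℂ) (hP : ∀ i ∈ S, ∀ v, ∀ h ∈ H, P i (v + h) = θ i h * P i v) (v : V) :
    av H (fun v => ‖∑ i ∈ S, P i v‖ ^ 2) v ≤ K * ∑ i ∈ S, ‖P i v‖ ^ 2 := by
  unfold av
  rw [div_le_iff₀ (card_pos' H)]
  have := block_orth (X := H) S π (fun i t => P i (v + t)) K hK ?_
  · refine this.trans (le_of_eq ?_)
    rw [mul_assoc, Finset.sum_mul]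
    congr 1
    refine Finset.sum_congr rfl fun i hi => ?_
    have : ∀ t : H, ‖P i (v + t)‖ ^ 2 = ‖P i v‖ ^ 2 := by
      intro t
      rw [hP i hi v t t.2, norm_mul, AddChar.norm_apply, one_mul]
    simp [this, mul_comm]
  · intro i hi j hj hij
    have hne : ∃ h ∈ H, θ i h ≠ θ j h := by
      by_contra hcon
      push Not at hcon
      exact hij (hθ i hi j hj hcon)
    obtain ⟨h, hh, hne⟩ := hne
    set Z := ∑ x : H, P i (v + x) * starRingEnd ℂ (P j (v + x)) with hZ
    have e1 : Z = ∑ x : H, P i (v + h + x) * starRingEnd ℂ (P j (v + h + x)) := by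
      rw [hZ]
      refine (Fintype.sum_equiv (Equiv.addLeft (⟨h, hh⟩ : H)) _ _ fun t => ?_).symm
      simp [add_assoc]
    have e2 : Z = (θ i h * starRingEnd ℂ (θ j h)) * Z := by
      conv_lhs => rw [e1]
      rw [hZ, Finset.mul_sum]
      refine Finset.sum_congr rfl fun x _ => ?_
      rw [show v + h + (x : V) = v + x + h by abel, hP i hi _ h hh, hP j hj _ h hh, map_mul]
      ring
    by_contra hZ0
    have e3 : θ i h * starRingEnd ℂ (θ j h) = 1 := by
      have : (θ i h * starRingEnd ℂ (θ j h)) * Z = 1 * Z := by rw [← e2, one_mul]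
      exact mul_right_cancel₀ hZ0 this
    have e4 : θ j h * starRingEnd ℂ (θ j h) = 1 := by
      rw [Complex.mul_conj', AddChar.norm_apply]; simp
    apply hne
    have h0 : starRingEnd ℂ (θ j h) ≠ 0 := by
      intro h0; rw [h0] at e4; simp at e4
    exact mul_right_cancel₀ h0 (e3.trans e4.symm)

end GenericLemmas

open MeasureTheory

section Geometry

theorem exists_val_split (q : ℕ) (u : ℤ) (ℓ : ℕ) (h : ¬ ((q : ℤ) ^ ℓ ∣ u)) :
    ∃ d < ℓ, ∃ u' : ℤ, u = (q : ℤ) ^ d * u' ∧ ¬ ((q : ℤ) ∣ u') := by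
  classical
  have hex : ∃ n, ¬ ((q : ℤ) ^ n ∣ u) := ⟨ℓ, h⟩
  have hpos : Nat.find hex ≠ 0 := by
    intro h0
    have := Nat.find_spec hex
    rw [h0] at this
    simp at this
  obtain ⟨d, hd⟩ := Nat.exists_eq_succ_of_ne_zero hpos
  have hdl : d < ℓ := by
    have := Nat.find_min' hex h
    omega
  have hdvd : (q : ℤ) ^ d ∣ u := by
    by_contra hc
    have := Nat.find_min' hex hc
    omega
  obtain ⟨u', hu'⟩ := hdvd
  refine ⟨d, hdl, u', hu', ?_⟩
  rintro ⟨w, hw⟩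
  have := Nat.find_spec hex
  rw [hd] at this
  apply this
  exact ⟨w, by rw [hu', hw, Nat.succ_eq_add_one]; ring⟩

theorem pow_dvd_of_mul (q : ℕ) (hq : q.Prime) (A B : ℤ) (n s : ℕ)
    (h : (q : ℤ) ^ n ∣ A * B) (hB : ¬ ((q : ℤ) ^ s ∣ B)) : (q : ℤ) ^ (n - s) ∣ A := by
  obtain ⟨d, hd, B', rfl, hB'⟩ := exists_val_split q B s hB
  have hp : Prime (q : ℤ) := Nat.prime_iff_prime_int.mp hq
  have hcop : IsCoprime ((q : ℤ) ^ (n - s)) B' := by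
    apply IsCoprime.pow_left
    exact (Prime.coprime_iff_not_dvd hp).mpr hB'
  apply hcop.dvd_of_dvd_mul_right
  have h0 : (q : ℤ) ^ d ≠ 0 := pow_ne_zero _ hp.ne_zero
  by_cases hn : n ≤ s
  · simp [Nat.sub_eq_zero_of_le hn]
  have h2 : (q : ℤ) ^ d * (q : ℤ) ^ (n - s) ∣ (q : ℤ) ^ d * (A * B') := by
    rw [← pow_add]
    refine (pow_dvd_pow _ (by omega)).trans ((h).trans (dvd_of_eq (by ring)))
  exact (mul_dvd_mul_iff_left h0).mp h2

variable {q M : ℕ}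

theorem zmod_qM (q M : ℕ) : ((q : ZMod (q ^ M)) ^ M) = 0 := by
  have := ZMod.natCast_self (q ^ M)
  push_cast at this
  exact this

theorem zmod_qpow (q M e : ℕ) (h : M ≤ e) : ((q : ZMod (q ^ M)) ^ e) = 0 := by
  obtain ⟨k, rfl⟩ := Nat.exists_eq_add_of_le h
  rw [pow_add, zmod_qM, zero_mul]

theorem zmod_kill [Fact q.Prime] (e : ℕ) (he : e ≤ M) (z : ZMod (q ^ M))
    (hz : (q : ZMod (q ^ M)) ^ e * z = 0) : ∃ z', z = (q : ZMod (q ^ M)) ^ (M - e) * z' := by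
  have hq : 0 < q := (Fact.out : q.Prime).pos
  have : NeZero (q ^ M) := ⟨(pow_pos hq M).ne'⟩
  have h1 : ((q ^ e * z.val : ℕ) : ZMod (q ^ M)) = 0 := by
    push_cast
    rw [ZMod.natCast_zmod_val]; exact hz
  rw [ZMod.natCast_eq_zero_iff] at h1
  have h2 : q ^ (M - e) ∣ z.val := by
    have : q ^ e * q ^ (M - e) ∣ q ^ e * z.val := by
      rw [← pow_add, Nat.add_sub_cancel' he]; exact h1
    exact (Nat.mul_dvd_mul_iff_left (pow_pos hq e)).mp this
  obtain ⟨w, hw⟩ := h2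
  refine ⟨(w : ZMod (q ^ M)), ?_⟩
  rw [← ZMod.natCast_zmod_val z, hw]
  push_cast; ring

theorem zmod_inv [Fact q.Prime] (u : ℤ) (hu : ¬ ((q : ℤ) ∣ u)) :
    ∃ w : ZMod (q ^ M), (u : ZMod (q ^ M)) * w = 1 := by
  have hp : Prime (q : ℤ) := Nat.prime_iff_prime_int.mp Fact.out
  have hcop : IsCoprime ((q : ℤ) ^ M) u :=
    IsCoprime.pow_left ((Prime.coprime_iff_not_dvd hp).mpr hu)
  obtain ⟨a, b, hab⟩ := hcop
  refine ⟨(b : ZMod (q ^ M)), ?_⟩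
  have := congrArg (Int.cast : ℤ → ZMod (q ^ M)) hab
  push_cast at this
  rw [zmod_qM, mul_zero, zero_add] at this
  rw [mul_comm]; exact this

theorem nondeg [Fact q.Prime] (ψ : AddChar (ZMod (q ^ M)) ℂ)
    (hψ : ψ ((q : ZMod (q ^ M)) ^ (M - 1)) ≠ 1) (u : ℤ) (ℓ : ℕ) (hℓ : ℓ ≤ M)
    (h : ∀ x : ZMod (q ^ M), (q : ZMod (q ^ M)) ^ ℓ * x = 0 → ψ (u * x) = 1) :
    (q : ℤ) ^ ℓ ∣ u := by
  by_contra hc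
  obtain ⟨d, hd, u', rfl, hu'⟩ := exists_val_split q u ℓ hc
  obtain ⟨w, hw⟩ := zmod_inv (M := M) u' hu'
  apply hψ
  rw [← h (w * (q : ZMod (q ^ M)) ^ (M - 1 - d)) ?_]
  · congr 1
    push_cast
    calc (q : ZMod (q ^ M)) ^ (M - 1) = (q : ZMod (q ^ M)) ^ (d + (M - 1 - d)) := by
          congr 1; omega
      _ = (q : ZMod (q ^ M)) ^ d * (q : ZMod (q ^ M)) ^ (M - 1 - d) * 1 := by rw [pow_add, mul_one]
      _ = _ := by rw [← hw]; ring
  · rw [mul_left_comm, ← pow_add, zmod_qpow _ _ _ (by omega), mul_zero]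

/-- dual parallelogram group of an interval with centre `c` of length `q^{-ℓ}` -/
def TT (q M : ℕ) (c ℓ : ℕ) : Set (ZMod (q ^ M) × ZMod (q ^ M)) :=
  {t | (q : ZMod (q ^ M)) ^ ℓ * (t.1 + 2 * c * t.2) = 0 ∧ (q : ZMod (q ^ M)) ^ (2 * ℓ) * t.2 = 0}

/-- The low frequency averaging group, adapted to the interval `a + q^{ℓ0}`. -/
def HH (q M : ℕ) (a ℓ0 ℓ : ℕ) : AddSubgroup (ZMod (q ^ M) × ZMod (q ^ M)) where
  carrier := {t | (q : ZMod (q ^ M)) ^ ℓ * (t.1 + 2 * a * t.2) = 0 ∧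
    (q : ZMod (q ^ M)) ^ (ℓ0 + ℓ) * t.2 = 0}
  zero_mem' := by simp
  add_mem' := by
    rintro t t' ⟨h1, h2⟩ ⟨h3, h4⟩
    refine ⟨?_, ?_⟩
    · simp only [Prod.fst_add, Prod.snd_add]
      linear_combination h1 + h3
    · simp only [Prod.snd_add]
      linear_combination h2 + h4
  neg_mem' := by
    rintro t ⟨h1, h2⟩
    refine ⟨?_, ?_⟩
    · simp only [Prod.fst_neg, Prod.snd_neg]
      linear_combination -h1
    · simp only [Prod.snd_neg]
      linear_combination -h2

/-- the character with integer frequencies -/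
def chr (ψ : AddChar (ZMod (q ^ M)) ℂ) (u v : ℤ) :
    AddChar (ZMod (q ^ M) × ZMod (q ^ M)) ℂ where
  toFun t := ψ (u * t.1 + v * t.2)
  map_zero_eq_one' := by simp
  map_add_eq_mul' t t' := by
    rw [← AddChar.map_add_eq_mul]; congr 1
    simp only [Prod.fst_add, Prod.snd_add]; ring

theorem chr_apply (ψ : AddChar (ZMod (q ^ M)) ℂ) (u v : ℤ) (t) :
    chr ψ u v t = ψ (u * t.1 + v * t.2) := rfl

/-- equivariance, i.e. Fourier support in the box over the interval -/
def Eqv (ψ : AddChar (ZMod (q ^ M)) ℂ) (c ℓ : ℕ) (f : ZMod (q ^ M) × ZMod (q ^ M) → ℂ) : Prop :=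
  ∀ v, ∀ t ∈ TT q M c ℓ, f (v + t) = chr ψ c ((c : ℤ) ^ 2) t * f v

theorem Eqv.norm_inv [Fact q.Prime] {ψ : AddChar (ZMod (q ^ M)) ℂ} {c ℓ : ℕ} {f}
    (h : Eqv ψ c ℓ f) (v) (t) (ht : t ∈ TT q M c ℓ) : ‖f (v + t)‖ = ‖f v‖ := by
  have : NeZero (q ^ M) := ⟨(pow_pos (Fact.out : q.Prime).pos M).ne'⟩
  rw [h v t ht, norm_mul, AddChar.norm_apply, one_mul]

theorem Eqv.trunc [Fact q.Prime] {ψ : AddChar (ZMod (q ^ M)) ℂ} {c ℓ : ℕ} {f}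
    (h : Eqv ψ c ℓ f) (lam : ℝ) :
    Eqv ψ c ℓ (fun v => if ‖f v‖ ≤ lam then f v else 0) := by
  intro v t ht
  simp only [h.norm_inv v t ht]
  split_ifs
  · exact h v t ht
  · simp

theorem Eqv.sum {ψ : AddChar (ZMod (q ^ M)) ℂ} {c ℓ : ℕ} {ι : Type*} (S : Finset ι)
    (f : ι → ZMod (q ^ M) × ZMod (q ^ M) → ℂ) (h : ∀ i ∈ S, Eqv ψ c ℓ (f i)) :
    Eqv ψ c ℓ (fun v => ∑ i ∈ S, f i v) := by
  intro v t ht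
  simp only [Finset.mul_sum]
  exact Finset.sum_congr rfl fun i hi => h i hi v t ht

theorem mod_split {c c' n : ℕ} (h : c' % n = c % n) : ∃ e : ℤ, (c' : ℤ) = c + n * e := by
  have : (c : ℤ) ≡ c' [ZMOD n] := (Int.natCast_modEq_iff).mpr h.symm
  obtain ⟨e, he⟩ := this.dvd
  exact ⟨e, by linarith⟩

theorem TT_mono {c c' ℓ ℓ' : ℕ} (hc : c' % q ^ ℓ = c % q ^ ℓ) (hℓ : ℓ ≤ ℓ') :
    TT q M c ℓ ⊆ TT q M c' ℓ' := by
  obtain ⟨e, he⟩ := mod_split hc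
  obtain ⟨d, rfl⟩ := Nat.exists_eq_add_of_le hℓ
  have he' : (c' : ZMod (q ^ M)) = c + q ^ ℓ * e := by
    have := congrArg (Int.cast : ℤ → ZMod (q ^ M)) he
    push_cast at this
    exact this
  rintro t ⟨h1, h2⟩
  refine ⟨?_, ?_⟩
  · rw [he', pow_add]
    have h2' : (q : ZMod (q ^ M)) ^ ℓ * (q : ZMod (q ^ M)) ^ ℓ * t.2 = 0 := by
      rw [← pow_add, ← two_mul]; exact h2
    linear_combination (q : ZMod (q ^ M)) ^ d * h1 + 2 * e * (q : ZMod (q ^ M)) ^ d * h2'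
  · rw [mul_add, pow_add]
    linear_combination (q : ZMod (q ^ M)) ^ (2 * d) * h2

theorem Eqv.mono {ψ : AddChar (ZMod (q ^ M)) ℂ} {c c' ℓ ℓ' : ℕ} {f}
    (hc : c' % q ^ ℓ = c % q ^ ℓ) (hℓ : ℓ ≤ ℓ') (h : Eqv ψ c' ℓ' f) : Eqv ψ c ℓ f := by
  intro v t ht
  rw [h v t (TT_mono hc hℓ ht)]
  congr 1
  rw [chr_apply, chr_apply]
  congr 1
  obtain ⟨e, he⟩ := mod_split hc
  have he' : (c' : ZMod (q ^ M)) = c + q ^ ℓ * e := by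
    have := congrArg (Int.cast : ℤ → ZMod (q ^ M)) he
    push_cast at this
    exact this
  obtain ⟨h1, h2⟩ := ht
  push_cast
  rw [he']
  have h2' : (q : ZMod (q ^ M)) ^ ℓ * (q : ZMod (q ^ M)) ^ ℓ * t.2 = 0 := by
    rw [← pow_add, ← two_mul]; exact h2
  linear_combination (e : ZMod (q ^ M)) * h1 + (e : ZMod (q ^ M)) ^ 2 * h2'

theorem HH_sub_TT {a ℓ0 ℓ c : ℕ} (hc : c % q ^ ℓ0 = a % q ^ ℓ0) (hℓ : ℓ0 ≤ ℓ) :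
    ∀ t ∈ HH q M a ℓ0 ℓ, t ∈ TT q M c ℓ := by
  obtain ⟨e, he⟩ := mod_split hc
  have he' : (c : ZMod (q ^ M)) = a + q ^ ℓ0 * e := by
    have := congrArg (Int.cast : ℤ → ZMod (q ^ M)) he
    push_cast at this
    exact this
  obtain ⟨d, rfl⟩ := Nat.exists_eq_add_of_le hℓ
  rintro t ⟨h1, h2⟩
  refine ⟨?_, ?_⟩
  · rw [he']
    rw [pow_add] at h2
    linear_combination h1 + 2 * e * h2
  · rw [show 2 * (ℓ0 + d) = (ℓ0 + (ℓ0 + d)) + d by ring, pow_add]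
    linear_combination (q : ZMod (q ^ M)) ^ d * h2

theorem HH_mono {a ℓ0 ℓ ℓ' : ℕ} (hℓ : ℓ ≤ ℓ') :
    ∀ t ∈ HH q M a ℓ0 ℓ, t ∈ HH q M a ℓ0 ℓ' := by
  obtain ⟨d, rfl⟩ := Nat.exists_eq_add_of_le hℓ
  rintro t ⟨h1, h2⟩
  refine ⟨?_, ?_⟩
  · rw [pow_add]
    linear_combination (q : ZMod (q ^ M)) ^ d * h1
  · rw [← add_assoc, pow_add]
    linear_combination (q : ZMod (q ^ M)) ^ d * h2

theorem HH_nondeg [Fact q.Prime] (ψ : AddChar (ZMod (q ^ M)) ℂ)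
    (hψ : ψ ((q : ZMod (q ^ M)) ^ (M - 1)) ≠ 1) (a ℓ0 ℓ : ℕ) (hM : ℓ0 + ℓ ≤ M) (u v u' v' : ℤ)
    (h : ∀ t ∈ HH q M a ℓ0 ℓ, chr ψ u v t = chr ψ u' v' t) :
    (q : ℤ) ^ ℓ ∣ u - u' ∧ (q : ℤ) ^ (ℓ0 + ℓ) ∣ (v - v') - 2 * a * (u - u') := by
  have h' : ∀ t ∈ HH q M a ℓ0 ℓ, ψ (((u - u' : ℤ) : ZMod (q ^ M)) * t.1
      + ((v - v' : ℤ) : ZMod (q ^ M)) * t.2) = 1 := by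
    intro t ht
    have e := h t ht
    rw [chr_apply, chr_apply] at e
    have e2 : ψ (((u - u' : ℤ) : ZMod (q ^ M)) * t.1 + ((v - v' : ℤ) : ZMod (q ^ M)) * t.2)
        * ψ (u' * t.1 + v' * t.2) = 1 * ψ (u' * t.1 + v' * t.2) := by
      rw [one_mul, ← AddChar.map_add_eq_mul]
      refine Eq.trans ?_ e
      congr 1
      push_cast; ring
    refine mul_right_cancel₀ ?_ e2
    have : ‖ψ (u' * t.1 + v' * t.2)‖ = 1 := by
      have : NeZero (q ^ M) := ⟨(pow_pos (Fact.out : q.Prime).pos M).ne'⟩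
      exact AddChar.norm_apply _ _
    intro h0
    rw [h0] at this
    simp at this
  refine ⟨nondeg ψ hψ _ ℓ (by omega) fun x hx => ?_, nondeg ψ hψ _ _ hM fun y hy => ?_⟩
  · have := h' (x, 0) ⟨by simpa using hx, by simp⟩
    simpa using this
  · have := h' (-2 * a * y, y) ⟨by simp, by simpa using hy⟩
    rw [← this]
    congr 1
    push_cast; ring

theorem HH_decomp [Fact q.Prime] (hq2 : q ≠ 2) {a ℓ0 ℓ s c c' : ℕ}
    (hc' : c' % q ^ ℓ0 = a % q ^ ℓ0)
    (hℓ : ℓ0 + s ≤ ℓ) (hM : 2 * ℓ ≤ M) (hcc : c % q ^ (ℓ - s) ≠ c' % q ^ (ℓ - s)) :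
    ∀ h ∈ HH q M a ℓ0 (ℓ + s), ∃ t ∈ TT q M c ℓ, ∃ t' ∈ TT q M c' ℓ, h = t + t' := by
  have hq : q.Prime := Fact.out
  rintro ⟨x, y⟩ hh
  have hcc' : ¬ ((q : ℤ) ^ (ℓ - s) ∣ (c : ℤ) - c') := by
    intro hd
    apply hcc
    have : (c' : ℤ) ≡ c [ZMOD ((q ^ (ℓ - s) : ℕ) : ℤ)] :=
      (Int.modEq_iff_dvd).mpr (by push_cast; exact hd)
    exact ((Int.natCast_modEq_iff).mp this).symm
  obtain ⟨d, hd, u, hu, hqu⟩ := exists_val_split q _ _ hcc'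
  have hq2u : ¬ ((q : ℤ) ∣ 2 * u) := by
    have hp : Prime (q : ℤ) := Nat.prime_iff_prime_int.mp hq
    intro h
    rcases hp.dvd_or_dvd h with h | h
    · have : q ∣ 2 := by exact_mod_cast h
      exact hq2 ((Nat.prime_dvd_prime_iff_eq hq Nat.prime_two).mp this)
    · exact hqu h
  obtain ⟨w, hw⟩ := zmod_inv (M := M) _ hq2u
  have hT := HH_sub_TT hc' (by omega : ℓ0 ≤ ℓ + s) _ hh
  obtain ⟨hz, -⟩ := hT
  obtain ⟨-, hy⟩ := hh
  simp only at hz hy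
  obtain ⟨z', hz'⟩ := zmod_kill (ℓ + s) (by omega) _ hz
  set y1 : ZMod (q ^ M) := -w * (q : ZMod (q ^ M)) ^ (M - (ℓ + s) - d) * z' with hy1
  have hcu : (c : ZMod (q ^ M)) - c' = (q : ZMod (q ^ M)) ^ d * u := by
    have := congrArg (Int.cast : ℤ → ZMod (q ^ M)) hu
    push_cast at this
    exact this
  have k1 : x + 2 * c' * y + 2 * (c - c') * y1 = 0 := by
    rw [hz', hcu, hy1]
    have : (q : ZMod (q ^ M)) ^ (M - (ℓ + s)) = (q : ZMod (q ^ M)) ^ d *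
        (q : ZMod (q ^ M)) ^ (M - (ℓ + s) - d) := by
      rw [← pow_add]; congr 1; omega
    rw [this]
    push_cast at hw
    linear_combination -(q : ZMod (q ^ M)) ^ d *
        (q : ZMod (q ^ M)) ^ (M - (ℓ + s) - d) * z' * hw
  have k2 : (q : ZMod (q ^ M)) ^ (2 * ℓ) * y1 = 0 := by
    rw [hy1]
    have : (q : ZMod (q ^ M)) ^ (2 * ℓ) * (q : ZMod (q ^ M)) ^ (M - (ℓ + s) - d) = 0 := by
      rw [← pow_add]; exact zmod_qpow _ _ _ (by omega)
    linear_combination -w * z' * this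
  have k3 : (q : ZMod (q ^ M)) ^ (2 * ℓ) * y = 0 := by
    obtain ⟨e, he⟩ := Nat.exists_eq_add_of_le (by omega : ℓ0 + (ℓ + s) ≤ 2 * ℓ)
    rw [he, pow_add]
    linear_combination (q : ZMod (q ^ M)) ^ e * hy
  refine ⟨(-2 * c * y1, y1), ⟨?_, k2⟩, (x + 2 * c * y1, y - y1), ⟨?_, ?_⟩, ?_⟩
  · simp
  · simp only
    linear_combination (q : ZMod (q ^ M)) ^ ℓ * k1
  · simp only
    linear_combination k3 - k2
  · ext <;> simp

theorem mod_of_dvd {c c' n : ℕ} (h : (n : ℤ) ∣ (c : ℤ) - c') : c % n = c' % n := by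
  have : (c' : ℤ) ≡ c [ZMOD (n : ℤ)] := (Int.modEq_iff_dvd).mpr h
  exact ((Int.natCast_modEq_iff).mp this).symm

theorem dvd_of_mod {c c' n : ℕ} (h : c % n = c' % n) : (n : ℤ) ∣ (c : ℤ) - c' := by
  obtain ⟨e, he⟩ := mod_split h
  exact ⟨e, by linarith⟩

theorem low_distinct [Fact q.Prime] (ψ : AddChar (ZMod (q ^ M)) ℂ)
    (hψ : ψ ((q : ZMod (q ^ M)) ^ (M - 1)) ≠ 1) (a ℓ0 ℓ : ℕ) (hM : ℓ0 + ℓ ≤ M) (c c' : ℕ)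
    (h : ∀ t ∈ HH q M a ℓ0 ℓ, chr ψ c ((c : ℤ) ^ 2) t = chr ψ c' ((c' : ℤ) ^ 2) t) :
    c % q ^ ℓ = c' % q ^ ℓ := by
  apply mod_of_dvd
  push_cast
  exact (HH_nondeg ψ hψ a ℓ0 ℓ hM _ _ _ _ h).1

theorem bil_distinct [Fact q.Prime] (hq2 : q ≠ 2) (ψ : AddChar (ZMod (q ^ M)) ℂ)
    (hψ : ψ ((q : ZMod (q ^ M)) ^ (M - 1)) ≠ 1) (a ℓ0 ℓ s : ℕ) (hM : ℓ0 + ℓ ≤ M)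
    (hℓ : ℓ0 + s ≤ ℓ) (c1 c1' c2 c2' : ℕ)
    (h1 : c1 % q ^ ℓ0 = a % q ^ ℓ0) (h1' : c1' % q ^ ℓ0 = a % q ^ ℓ0)
    (h2 : c2 % q ^ ℓ0 = a % q ^ ℓ0) (h2' : c2' % q ^ ℓ0 = a % q ^ ℓ0)
    (h12 : c1 % q ^ (ℓ0 + s) = c2 % q ^ (ℓ0 + s))
    (h12' : c1' % q ^ (ℓ0 + s) = c2' % q ^ (ℓ0 + s))
    (hne : c1 % q ^ (ℓ0 + s) ≠ c1' % q ^ (ℓ0 + s))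
    (h : ∀ t ∈ HH q M a ℓ0 ℓ, chr ψ (c1 + c1') ((c1 : ℤ) ^ 2 + (c1' : ℤ) ^ 2) t
      = chr ψ (c2 + c2') ((c2 : ℤ) ^ 2 + (c2' : ℤ) ^ 2) t) :
    c1 % q ^ (ℓ - s) = c2 % q ^ (ℓ - s) ∧ c1' % q ^ (ℓ - s) = c2' % q ^ (ℓ - s) := by
  have hq : q.Prime := Fact.out
  have hp : Prime (q : ℤ) := Nat.prime_iff_prime_int.mp hq
  have hcop2 : ∀ n : ℕ, IsCoprime ((q : ℤ) ^ n) 2 := by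
    intro n
    apply IsCoprime.pow_left
    refine (Prime.coprime_iff_not_dvd hp).mpr ?_
    intro h
    have : q ∣ 2 := by exact_mod_cast h
    exact hq2 ((Nat.prime_dvd_prime_iff_eq hq Nat.prime_two).mp this)
  obtain ⟨hu, hv⟩ := HH_nondeg ψ hψ a ℓ0 ℓ hM _ _ _ _ h
  obtain ⟨e1, E1⟩ := mod_split h1
  obtain ⟨e1', E1'⟩ := mod_split h1'
  obtain ⟨e2, E2⟩ := mod_split h2
  obtain ⟨e2', E2'⟩ := mod_split h2'
  push_cast at E1 E1' E2 E2'
  obtain ⟨n, rfl⟩ := Nat.exists_eq_add_of_le (by omega : ℓ0 ≤ ℓ)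
  set Q : ℤ := (q : ℤ) ^ ℓ0 with hQ
  have hQ0 : Q ≠ 0 := pow_ne_zero _ hp.ne_zero
  have hQQ0 : Q * Q ≠ 0 := mul_ne_zero hQ0 hQ0
  -- reduce
  have hU : (q : ℤ) ^ n ∣ e1 + e1' - e2 - e2' := by
    rw [pow_add] at hu
    refine (mul_dvd_mul_iff_left hQ0).mp (hu.trans (dvd_of_eq ?_))
    rw [E1, E1', E2, E2']; ring
  have hVV : (q : ℤ) ^ n ∣ e1 ^ 2 + e1' ^ 2 - e2 ^ 2 - e2' ^ 2 := by
    rw [pow_add, pow_add, ← mul_assoc] at hv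
    refine (mul_dvd_mul_iff_left hQQ0).mp (hv.trans (dvd_of_eq ?_))
    rw [E1, E1', E2, E2']; ring
  have hs1 : (q : ℤ) ^ s ∣ e1 - e2 := by
    have := dvd_of_mod h12
    push_cast at this
    rw [pow_add] at this
    refine (mul_dvd_mul_iff_left hQ0).mp (this.trans (dvd_of_eq ?_))
    rw [E1, E2]; ring
  have hs1' : (q : ℤ) ^ s ∣ e1' - e2' := by
    have := dvd_of_mod h12'
    push_cast at this
    rw [pow_add] at this
    refine (mul_dvd_mul_iff_left hQ0).mp (this.trans (dvd_of_eq ?_))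
    rw [E1', E2']; ring
  have hsn : ¬ (q : ℤ) ^ s ∣ e1 - e1' := by
    intro hd
    apply hne
    apply mod_of_dvd
    push_cast
    rw [pow_add]
    refine (mul_dvd_mul_left Q hd).trans (dvd_of_eq ?_)
    rw [E1, E1']; ring
  have hB : ¬ (q : ℤ) ^ s ∣ (e1 - e1') + (e2 - e2') := by
    intro hd
    apply hsn
    apply (hcop2 s).dvd_of_dvd_mul_left
    have : 2 * (e1 - e1') = ((e1 - e1') + (e2 - e2')) + (e1 - e2) - (e1' - e2') := by ring
    rw [this]
    exact dvd_sub (dvd_add hd hs1) hs1'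
  have hAB : (q : ℤ) ^ n ∣ ((e1 - e1') - (e2 - e2')) * ((e1 - e1') + (e2 - e2')) := by
    have : ((e1 - e1') - (e2 - e2')) * ((e1 - e1') + (e2 - e2'))
        = 2 * (e1 ^ 2 + e1' ^ 2 - e2 ^ 2 - e2' ^ 2)
          - (e1 + e1' - e2 - e2') * (e1 + e1' + e2 + e2') := by ring
    rw [this]
    exact dvd_sub (Dvd.dvd.mul_left hVV _) (Dvd.dvd.mul_right hU _)
  have hA := pow_dvd_of_mul q hq _ _ n s hAB hB
  have hU' : (q : ℤ) ^ (n - s) ∣ e1 + e1' - e2 - e2' := (pow_dvd_pow _ (Nat.sub_le _ _)).trans hU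
  have hexp : ℓ0 + n - s = ℓ0 + (n - s) := by omega
  rw [hexp]
  constructor
  · have : (q : ℤ) ^ (n - s) ∣ e1 - e2 := by
      apply (hcop2 _).dvd_of_dvd_mul_left
      have e : 2 * (e1 - e2) = (e1 + e1' - e2 - e2') + ((e1 - e1') - (e2 - e2')) := by ring
      rw [e]; exact dvd_add hU' hA
    apply mod_of_dvd
    push_cast
    rw [pow_add]
    refine (mul_dvd_mul_left Q this).trans (dvd_of_eq ?_)
    rw [E1, E2]; ring
  · have : (q : ℤ) ^ (n - s) ∣ e1' - e2' := by
      apply (hcop2 _).dvd_of_dvd_mul_left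
      have e : 2 * (e1' - e2') = (e1 + e1' - e2 - e2') - ((e1 - e1') - (e2 - e2')) := by ring
      rw [e]; exact dvd_sub hU' hA
    apply mod_of_dvd
    push_cast
    rw [pow_add]
    refine (mul_dvd_mul_left Q this).trans (dvd_of_eq ?_)
    rw [E1', E2']; ring

end Geometry

open MeasureTheory

section Tree

variable {q M : ℕ}

noncomputable instance instFintypeHH [Fact q.Prime] (a ℓ0 ℓ : ℕ) : Fintype (HH q M a ℓ0 ℓ) :=
  Fintype.ofFinite _

/-- nodes at level `j` -/
def SS (q s k a j : ℕ) : Finset ℕ :=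
  (Finset.range (q ^ (j * s))).filter (fun b => b % q ^ (k * s) = a % q ^ (k * s))

/-- the pruned functions, at level `J - i` -/
noncomputable def raw (M q s k a J : ℕ) (lam : ℝ) (F : ℕ → ZMod (q ^ M) × ZMod (q ^ M) → ℂ) :
    ℕ → ℕ → ZMod (q ^ M) × ZMod (q ^ M) → ℂ
  | 0 => F
  | i + 1 => fun b v => ∑ b' ∈ (SS q s k a (J - i)).filter (fun b' => b' % q ^ ((J - (i + 1)) * s) = b),
      if ‖raw M q s k a J lam F i b' v‖ ≤ lam then raw M q s k a J lam F i b' v else 0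

/-- square function -/
noncomputable def gg (M q s k a J : ℕ) (lam : ℝ) (F : ℕ → ZMod (q ^ M) × ZMod (q ^ M) → ℂ)
    (i : ℕ) (v : ZMod (q ^ M) × ZMod (q ^ M)) : ℝ :=
  ∑ b ∈ SS q s k a (J - i), ‖raw M q s k a J lam F i b v‖ ^ 2

/-- pruned function on an interval of level `k+1` -/
noncomputable def FF (M q s k a J : ℕ) (lam : ℝ) (F : ℕ → ZMod (q ^ M) × ZMod (q ^ M) → ℂ)
    (i σ : ℕ) (v : ZMod (q ^ M) × ZMod (q ^ M)) : ℂ :=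
  ∑ b ∈ (SS q s k a (J - i)).filter (fun b => b % q ^ ((k + 1) * s) = σ),
    raw M q s k a J lam F i b v

theorem gg_nonneg (s k a J : ℕ) (lam : ℝ) (F) (i v) : 0 ≤ gg M q s k a J lam F i v :=
  Finset.sum_nonneg fun _ _ => by positivity

theorem card_fiber_le [Fact q.Prime] (n s c : ℕ) (S : Finset ℕ)
    (hS : ∀ b ∈ S, b < q ^ (n + s)) (hc : ∀ b ∈ S, b % q ^ n = c) : S.card ≤ q ^ s := by
  have hq : 0 < q := (Fact.out : q.Prime).pos
  rw [← Finset.card_range (q ^ s)]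
  refine Finset.card_le_card_of_injOn (fun b => b / q ^ n) ?_ ?_
  · intro b hb
    have := hS b hb
    simp only [Finset.coe_range, Set.mem_Iio]
    rw [Nat.div_lt_iff_lt_mul (pow_pos hq n), mul_comm, ← pow_add]
    exact this
  · intro b hb b' hb' h
    simp only at h
    rw [← Nat.div_add_mod b (q ^ n), ← Nat.div_add_mod b' (q ^ n), h, hc b hb, hc b' hb']

theorem SS_lt {s k a j b : ℕ} (h : b ∈ SS q s k a j) : b < q ^ (j * s) := by
  simpa using (Finset.mem_filter.mp h).1

theorem SS_mod {s k a j b : ℕ} (h : b ∈ SS q s k a j) : b % q ^ (k * s) = a % q ^ (k * s) :=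
  (Finset.mem_filter.mp h).2

theorem mod_mod_pow (b : ℕ) {m n : ℕ} (h : m ≤ n) : b % q ^ n % q ^ m = b % q ^ m :=
  Nat.mod_mod_of_dvd _ (pow_dvd_pow _ h)

theorem SS_parent [Fact q.Prime] {s k a j j' b : ℕ} (h : b ∈ SS q s k a j) (hk : k ≤ j') :
    b % q ^ (j' * s) ∈ SS q s k a j' := by
  have hq : 0 < q := (Fact.out : q.Prime).pos
  refine Finset.mem_filter.mpr ⟨?_, ?_⟩
  · simpa using Nat.mod_lt _ (pow_pos hq _)
  · rw [mod_mod_pow b (Nat.mul_le_mul_right s hk)]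
    exact SS_mod h

theorem raw_eqv [Fact q.Prime] (s k a J : ℕ) (lam : ℝ)
    (F : ℕ → ZMod (q ^ M) × ZMod (q ^ M) → ℂ)
    (ψ : AddChar (ZMod (q ^ M)) ℂ) (hF : ∀ b ∈ SS q s k a J, Eqv ψ b (J * s) (F b)) :
    ∀ i, ∀ b ∈ SS q s k a (J - i), Eqv ψ b ((J - i) * s) (raw M q s k a J lam F i b) := by
  intro i
  induction i with
  | zero => simpa [raw] using hF
  | succ i ih =>
    intro b hb
    simp only [raw]
    apply Eqv.sum
    intro b' hb'
    obtain ⟨h1, h2⟩ := Finset.mem_filter.mp hb'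
    refine Eqv.mono (c' := b') (ℓ' := (J - i) * s) ?_ (Nat.mul_le_mul_right s (by omega))
      ((ih b' h1).trunc lam)
    rw [h2, Nat.mod_eq_of_lt (SS_lt hb)]

theorem gg_inv [Fact q.Prime] (s k a J : ℕ) (lam : ℝ)
    (F : ℕ → ZMod (q ^ M) × ZMod (q ^ M) → ℂ)
    (ψ : AddChar (ZMod (q ^ M)) ℂ) (hF : ∀ b ∈ SS q s k a J, Eqv ψ b (J * s) (F b))
    (i ℓ : ℕ) (hk : k ≤ J - i) (hℓ : ℓ ≤ (J - i) * s) (v t)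
    (ht : t ∈ HH q M a (k * s) ℓ) :
    gg M q s k a J lam F i (v + t) = gg M q s k a J lam F i v := by
  unfold gg
  refine Finset.sum_congr rfl fun b hb => ?_
  rw [(raw_eqv s k a J lam F ψ hF i b hb).norm_inv v t]
  exact HH_sub_TT (SS_mod hb) (Nat.mul_le_mul_right s hk) t (HH_mono hℓ t ht)

/-- low lemma in general form -/
theorem low_general [Fact q.Prime] (s k a j : ℕ)
    (ψ : AddChar (ZMod (q ^ M)) ℂ) (hψ : ψ ((q : ZMod (q ^ M)) ^ (M - 1)) ≠ 1)
    (hk : k ≤ j) (hM : 2 * (j * s) ≤ M) (S : Finset ℕ) (hS : S ⊆ SS q s k a j)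
    (P : ℕ → ZMod (q ^ M) × ZMod (q ^ M) → ℂ) (hP : ∀ b ∈ S, Eqv ψ b (j * s) (P b)) (v) :
    av (HH q M a (k * s) (j * s)) (fun v => ‖∑ b ∈ S, P b v‖ ^ 2) v ≤ ∑ b ∈ S, ‖P b v‖ ^ 2 := by
  have hks : k * s ≤ j * s := Nat.mul_le_mul_right s hk
  have := av_sq_le (HH q M a (k * s) (j * s)) S (fun b => b) 1 ?_
    (fun b => chr ψ b ((b : ℤ) ^ 2)) ?_ P ?_ v
  · simpa using this
  · intro i hi
    have : S.filter (fun j => j = i) ⊆ {i} := by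
      intro x hx
      simpa using (Finset.mem_filter.mp hx).2
    have := Finset.card_le_card this
    simp at this
    exact_mod_cast this
  · intro b hb b' hb' h
    have := low_distinct ψ hψ a (k * s) (j * s) (by omega) b b' h
    rwa [Nat.mod_eq_of_lt (SS_lt (hS hb)), Nat.mod_eq_of_lt (SS_lt (hS hb'))] at this
  · intro b hb v t ht
    exact hP b hb v t (HH_sub_TT (SS_mod (hS hb)) hks t ht)

theorem low_lemma [Fact q.Prime] (s k a J : ℕ) (lam : ℝ)
    (F : ℕ → ZMod (q ^ M) × ZMod (q ^ M) → ℂ)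
    (ψ : AddChar (ZMod (q ^ M)) ℂ) (hψ : ψ ((q : ZMod (q ^ M)) ^ (M - 1)) ≠ 1)
    (hF : ∀ b ∈ SS q s k a J, Eqv ψ b (J * s) (F b)) (hM : 2 * (J * s) ≤ M)
    (i : ℕ) (hk : k ≤ J - (i + 1)) (v) :
    av (HH q M a (k * s) ((J - i) * s)) (gg M q s k a J lam F (i + 1)) v
      ≤ gg M q s k a J lam F i v := by
  have hJs : (J - i) * s ≤ J * s := Nat.mul_le_mul_right s (by omega)
  unfold gg
  rw [av_sum_comm]
  rw [← Finset.sum_fiberwise_of_maps_to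
    (s := SS q s k a (J - i)) (t := SS q s k a (J - (i + 1)))
    (g := fun b' => b' % q ^ ((J - (i + 1)) * s)) (fun b' hb' => SS_parent hb' hk)]
  refine Finset.sum_le_sum fun b hb => ?_
  simp only [raw]
  refine (low_general s k a (J - i) ψ hψ (by omega) (by omega) _ (Finset.filter_subset _ _) _
    ?_ v).trans ?_
  · intro b' hb'
    exact (raw_eqv s k a J lam F ψ hF i b' (Finset.mem_filter.mp hb').1).trunc lam
  · refine Finset.sum_le_sum fun b' _ => ?_
    split_ifs
    · exact le_rfl
    · simp

theorem energy [Fact q.Prime] (s k a J : ℕ) (lam : ℝ)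
    (F : ℕ → ZMod (q ^ M) × ZMod (q ^ M) → ℂ)
    (ψ : AddChar (ZMod (q ^ M)) ℂ) (hψ : ψ ((q : ZMod (q ^ M)) ^ (M - 1)) ≠ 1)
    (hF : ∀ b ∈ SS q s k a J, Eqv ψ b (J * s) (F b)) (hM : 2 * (J * s) ≤ M) :
    ∀ i, k ≤ J - i → ∑ x, gg M q s k a J lam F i x ≤ ∑ x, gg M q s k a J lam F 0 x := by
  intro i
  induction i with
  | zero => intro _; exact le_rfl
  | succ i ih =>
    intro hk
    refine le_trans ?_ (ih (by omega))
    rw [sum_av_univ (HH q M a (k * s) ((J - i) * s))]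
    exact Finset.sum_le_sum fun x _ => low_lemma s k a J lam F ψ hψ hF hM i hk x

theorem raw_bound [Fact q.Prime] (s k a J : ℕ) (lam : ℝ) (hlam : 0 ≤ lam)
    (F : ℕ → ZMod (q ^ M) × ZMod (q ^ M) → ℂ) (i : ℕ) (hi : i + 1 ≤ J) (b v) :
    ‖raw M q s k a J lam F (i + 1) b v‖ ≤ (q : ℝ) ^ s * lam := by
  simp only [raw]
  refine (norm_sum_le _ _).trans ?_
  refine (Finset.sum_le_card_nsmul _ _ lam ?_).trans ?_
  · intro b' _
    split_ifs with h
    · exact h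
    · simpa using hlam
  · rw [nsmul_eq_mul]
    refine mul_le_mul_of_nonneg_right ?_ hlam
    have := card_fiber_le (q := q) ((J - (i + 1)) * s) s b
      ((SS q s k a (J - i)).filter (fun b' => b' % q ^ ((J - (i + 1)) * s) = b)) ?_ ?_
    · exact_mod_cast this
    · intro b' hb'
      have h1 := SS_lt (Finset.mem_filter.mp hb').1
      have : (J - i) * s = (J - (i + 1)) * s + s := by
        obtain ⟨d, rfl⟩ := Nat.exists_eq_add_of_le hi
        rw [show i + 1 + d - i = d + 1 by omega, show i + 1 + d - (i + 1) = d by omega]; ring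
      rwa [this] at h1
    · intro b' hb'; exact (Finset.mem_filter.mp hb').2

theorem high_lemma [Fact q.Prime] (hq2 : q ≠ 2) (s k a J : ℕ) (lam : ℝ) (hlam : 0 ≤ lam)
    (F : ℕ → ZMod (q ^ M) × ZMod (q ^ M) → ℂ)
    (ψ : AddChar (ZMod (q ^ M)) ℂ)
    (hF : ∀ b ∈ SS q s k a J, Eqv ψ b (J * s) (F b)) (hM : 2 * (J * s) ≤ M)
    (i : ℕ) (hk : k + 1 ≤ J - (i + 1)) :
    ∑ x, (gg M q s k a J lam F (i + 1) x
        - av (HH q M a (k * s) ((J - i) * s)) (gg M q s k a J lam F (i + 1)) x) ^ 2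
      ≤ (q : ℝ) ^ s * (2 * ((q : ℝ) ^ s * lam) ^ 2 * ∑ x, gg M q s k a J lam F (i + 1) x) := by
  set H := HH q M a (k * s) ((J - i) * s) with hH
  set w : ℕ → ZMod (q ^ M) × ZMod (q ^ M) → ℝ :=
    fun b v => ‖raw M q s k a J lam F (i + 1) b v‖ ^ 2 with hw
  set u : ℕ → ZMod (q ^ M) × ZMod (q ^ M) → ℝ := fun b v => w b v - av H (w b) v with hu
  set S := SS q s k a (J - (i + 1)) with hS
  set j := J - (i + 1) with hj
  have hji : J - i = j + 1 := by omega
  have hlev : (J - i) * s = j * s + s := by rw [hji]; ring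
  have hlev2 : j * s = (j - 1) * s + s := by
    obtain ⟨d, hd⟩ : ∃ d, j = d + 1 := ⟨j - 1, by omega⟩
    rw [hd]; simp; ring
  have hks : k * s + s ≤ j * s := by
    have : (k + 1) * s ≤ j * s := Nat.mul_le_mul_right s hk
    linarith
  have hjJ : j * s ≤ J * s := Nat.mul_le_mul_right s (by omega)
  have hwB : ∀ b v, w b v ≤ ((q : ℝ) ^ s * lam) ^ 2 := by
    intro b v
    exact pow_le_pow_left₀ (norm_nonneg _) (raw_bound s k a J lam hlam F i (by omega) b v) 2
  have hw0 : ∀ b v, 0 ≤ w b v := fun b v => by positivity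
  have hwT : ∀ b ∈ S, ∀ v, ∀ t ∈ TT q M b (j * s), w b (v + t) = w b v := by
    intro b hb v t ht
    simp only [hw]
    rw [(raw_eqv s k a J lam F ψ hF (i + 1) b hb).norm_inv v t ht]
  have huT : ∀ b ∈ S, ∀ v, ∀ t ∈ TT q M b (j * s), u b (v + t) = u b v := by
    intro b hb v t ht
    simp only [hu]
    rw [hwT b hb v t ht]
    congr 1
    unfold av
    congr 1
    refine Finset.sum_congr rfl fun h _ => ?_
    rw [show v + t + (h : ZMod (q ^ M) × ZMod (q ^ M)) = v + h + t by abel, hwT b hb _ t ht]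
  have huz : ∀ b v, ∑ h : H, u b (v + h) = 0 := by
    intro b v
    simp only [hu, Finset.sum_sub_distrib]
    have : ∀ h : H, av H (w b) (v + h) = av H (w b) v := fun h => av_inv H _ v h h.2
    simp only [this]
    rw [Finset.sum_const, nsmul_eq_mul, Finset.card_univ]
    unfold av
    rw [mul_div_cancel₀ _ (card_pos' H).ne', sub_self]
  have e1 : ∀ x, gg M q s k a J lam F (i + 1) x - av H (gg M q s k a J lam F (i + 1)) x
      = ∑ b ∈ S, u b x := by
    intro x
    simp only [hu, Finset.sum_sub_distrib]
    unfold gg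
    rw [av_sum_comm]
  have hbo := block_orth (X := ZMod (q ^ M) × ZMod (q ^ M)) S (fun b => b % q ^ ((j - 1) * s))
    (fun b x => (u b x : ℂ)) ((q : ℝ) ^ s) ?_ ?_
  · have l1 : ∑ x, (gg M q s k a J lam F (i + 1) x - av H (gg M q s k a J lam F (i + 1)) x) ^ 2
        = ∑ x, ‖∑ b ∈ S, (u b x : ℂ)‖ ^ 2 := by
      refine Finset.sum_congr rfl fun x _ => ?_
      rw [e1, ← Complex.ofReal_sum, Complex.norm_real, Real.norm_eq_abs, sq_abs]
    rw [l1]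
    refine hbo.trans (mul_le_mul_of_nonneg_left ?_ (by positivity))
    have l2 : ∀ b ∈ S, ∑ x, ‖(u b x : ℂ)‖ ^ 2
        ≤ 2 * ((q : ℝ) ^ s * lam) ^ 2 * ∑ x, w b x := by
      intro b _
      have hsum := sum_av_univ H (w b)
      have : ∀ x, ‖(u b x : ℂ)‖ ^ 2 ≤ ((q : ℝ) ^ s * lam) ^ 2 * (w b x + av H (w b) x) := by
        intro x
        rw [Complex.norm_real, Real.norm_eq_abs, sq_abs]
        have a1 := hwB b x
        have a2 := av_le H (w b) _ (hwB b) x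
        have a3 := hw0 b x
        have a4 := av_nonneg H (w b) (hw0 b) x
        simp only [hu]
        nlinarith [mul_nonneg a3 a4, mul_nonneg a3 (sub_nonneg.mpr a1),
          mul_nonneg a4 (sub_nonneg.mpr a2)]
      calc ∑ x, ‖(u b x : ℂ)‖ ^ 2
          ≤ ∑ x, ((q : ℝ) ^ s * lam) ^ 2 * (w b x + av H (w b) x) :=
            Finset.sum_le_sum fun x _ => this x
        _ = _ := by
            rw [← Finset.mul_sum, Finset.sum_add_distrib, ← hsum]; ring
    refine (Finset.sum_le_sum l2).trans (le_of_eq ?_)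
    rw [← Finset.mul_sum, Finset.sum_comm]
    rfl
  · intro b hb
    have := card_fiber_le (q := q) ((j - 1) * s) s (b % q ^ ((j - 1) * s))
      (S.filter (fun b' => b' % q ^ ((j - 1) * s) = b % q ^ ((j - 1) * s))) ?_ ?_
    · exact_mod_cast this
    · intro b' hb'
      have h1 := SS_lt (Finset.mem_filter.mp hb').1
      rwa [hlev2] at h1
    · intro b' hb'; exact (Finset.mem_filter.mp hb').2
  · intro b hb b' hb' hne
    have hz := high_orth H (TT q M b (j * s)) (TT q M b' (j * s)) ?_ (u b) (u b')
      (huT b hb) (huT b' hb') (huz b)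
    · have : ∑ x, (u b x : ℂ) * starRingEnd ℂ (u b' x : ℂ) = ((∑ x, u b x * u b' x : ℝ) : ℂ) := by
        push_cast
        refine Finset.sum_congr rfl fun x _ => ?_
        rw [Complex.conj_ofReal]
      rw [this, hz]; simp
    · rw [hH, hlev]
      refine HH_decomp hq2 (SS_mod hb') hks (by omega) ?_
      have : j * s - s = (j - 1) * s := by omega
      rw [this]; exact hne

open Classical in
theorem bil_lemma [Fact q.Prime] (hq2 : q ≠ 2) (s k a J : ℕ) (lam : ℝ)
    (F : ℕ → ZMod (q ^ M) × ZMod (q ^ M) → ℂ)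
    (ψ : AddChar (ZMod (q ^ M)) ℂ) (hψ : ψ ((q : ZMod (q ^ M)) ^ (M - 1)) ≠ 1)
    (hF : ∀ b ∈ SS q s k a J, Eqv ψ b (J * s) (F b)) (hM : 2 * (J * s) ≤ M)
    (i : ℕ) (hk : k + 1 ≤ J - i) (p : ZMod (q ^ M) × ZMod (q ^ M) → Prop)
    (hp : ∀ v, ∀ h ∈ HH q M a (k * s) ((J - i) * s), p (v + h) → p v) :
    ∑ x with p x, ∑ σ ∈ SS q s k a (k + 1), ∑ σ' ∈ SS q s k a (k + 1),
      (if σ ≠ σ' then ‖FF M q s k a J lam F i σ x * FF M q s k a J lam F i σ' x‖ ^ 2 else 0)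
    ≤ (q : ℝ) ^ (2 * s) * ∑ x with p x, (gg M q s k a J lam F i x) ^ 2 := by
  set H := HH q M a (k * s) ((J - i) * s) with hH
  set j := J - i with hj
  set S := SS q s k a j with hS
  have hlev2 : j * s = (j - 1) * s + s := by
    obtain ⟨d, hd⟩ : ∃ d, j = d + 1 := ⟨j - 1, by omega⟩
    rw [hd]; simp; ring
  have hks : k * s + s ≤ j * s := by
    have : (k + 1) * s ≤ j * s := Nat.mul_le_mul_right s hk
    linarith
  have hk1 : (k + 1) * s = k * s + s := by ring
  have hjJ : j * s ≤ J * s := Nat.mul_le_mul_right s (by omega)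
  have hE := raw_eqv s k a J lam F ψ hF i
  rw [← hj] at hE
  set r : ℕ → ZMod (q ^ M) × ZMod (q ^ M) → ℂ := raw M q s k a J lam F i with hr
  set Sσ : ℕ → Finset ℕ := fun σ => S.filter (fun b => b % q ^ ((k + 1) * s) = σ) with hSσ
  -- pointwise average bound
  have key : ∀ σ σ', σ ≠ σ' → ∀ v,
      av H (fun x => ‖FF M q s k a J lam F i σ x * FF M q s k a J lam F i σ' x‖ ^ 2) v
        ≤ (q : ℝ) ^ (2 * s) * ((∑ b ∈ Sσ σ, ‖r b v‖ ^ 2) * (∑ b ∈ Sσ σ', ‖r b v‖ ^ 2)) := by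
    intro σ σ' hne v
    have := av_sq_le H (Sσ σ ×ˢ Sσ σ')
      (fun b => (b.1 % q ^ ((j - 1) * s), b.2 % q ^ ((j - 1) * s))) ((q : ℝ) ^ (2 * s)) ?_
      (fun b => chr ψ (b.1 + b.2) ((b.1 : ℤ) ^ 2 + (b.2 : ℤ) ^ 2)) ?_
      (fun b x => r b.1 x * r b.2 x) ?_ v
    · have e : ∀ x, ∑ b ∈ Sσ σ ×ˢ Sσ σ', r b.1 x * r b.2 x
          = FF M q s k a J lam F i σ x * FF M q s k a J lam F i σ' x := by
        intro x
        unfold FF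
        rw [Finset.sum_mul_sum, Finset.sum_product]
      simp only [e] at this
      refine this.trans (le_of_eq ?_)
      congr 1
      rw [Finset.sum_mul_sum, Finset.sum_product]
      refine Finset.sum_congr rfl fun b _ => Finset.sum_congr rfl fun b' _ => ?_
      rw [norm_mul, mul_pow]
    · rintro ⟨b, b'⟩ hb
      have hsub : (Sσ σ ×ˢ Sσ σ').filter (fun c => (c.1 % q ^ ((j - 1) * s), c.2 % q ^ ((j - 1) * s))
          = (b % q ^ ((j - 1) * s), b' % q ^ ((j - 1) * s)))
          ⊆ (S.filter (fun c => c % q ^ ((j - 1) * s) = b % q ^ ((j - 1) * s))) ×ˢ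
            (S.filter (fun c => c % q ^ ((j - 1) * s) = b' % q ^ ((j - 1) * s))) := by
        rintro ⟨c, c'⟩ hc
        simp only [Finset.mem_filter, Finset.mem_product, hSσ, Prod.mk.injEq] at hc ⊢
        tauto
      have hcard : ∀ b, (S.filter (fun c => c % q ^ ((j - 1) * s) = b % q ^ ((j - 1) * s))).card
          ≤ q ^ s := by
        intro b
        refine card_fiber_le (q := q) ((j - 1) * s) s (b % q ^ ((j - 1) * s)) _ ?_ ?_
        · intro b' hb'
          have h1 := SS_lt (Finset.mem_filter.mp hb').1
          rwa [hlev2] at h1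
        · intro b' hb'; exact (Finset.mem_filter.mp hb').2
      have h1 := (Finset.card_le_card hsub).trans
        ((Finset.card_product _ _).trans_le (Nat.mul_le_mul (hcard b) (hcard b')))
      rw [← pow_add, ← two_mul] at h1
      exact_mod_cast h1
    · rintro ⟨b1, b1'⟩ hb1 ⟨b2, b2'⟩ hb2 h
      obtain ⟨h1, h1'⟩ := Finset.mem_product.mp hb1
      obtain ⟨h2, h2'⟩ := Finset.mem_product.mp hb2
      obtain ⟨h1, m1⟩ := Finset.mem_filter.mp h1
      obtain ⟨h1', m1'⟩ := Finset.mem_filter.mp h1'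
      obtain ⟨h2, m2⟩ := Finset.mem_filter.mp h2
      obtain ⟨h2', m2'⟩ := Finset.mem_filter.mp h2'
      simp only at h1 h1' h2 h2' m1 m1' m2 m2' h
      rw [hk1] at m1 m1' m2 m2'
      have := bil_distinct hq2 ψ hψ a (k * s) (j * s) s (by omega) hks b1 b1' b2 b2'
        (SS_mod h1) (SS_mod h1') (SS_mod h2) (SS_mod h2') (m1.trans m2.symm) (m1'.trans m2'.symm)
        (by rw [m1, m1']; exact hne) h
      rw [show j * s - s = (j - 1) * s by omega] at this
      simp only [this.1, this.2]
    · rintro ⟨b, b'⟩ hb v t ht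
      obtain ⟨h1, h1'⟩ := Finset.mem_product.mp hb
      obtain ⟨h1, m1⟩ := Finset.mem_filter.mp h1
      obtain ⟨h1', m1'⟩ := Finset.mem_filter.mp h1'
      simp only at h1 h1' ⊢
      rw [hE b h1 v t (HH_sub_TT (SS_mod h1) (by omega) t ht),
        hE b' h1' v t (HH_sub_TT (SS_mod h1') (by omega) t ht)]
      have : chr ψ (b + b') ((b : ℤ) ^ 2 + (b' : ℤ) ^ 2) t
          = chr ψ b ((b : ℤ) ^ 2) t * chr ψ b' ((b' : ℤ) ^ 2) t := by
        rw [chr_apply, chr_apply, chr_apply, ← AddChar.map_add_eq_mul]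
        congr 1
        push_cast; ring
      rw [this]; ring
  have hgsum : ∀ x, gg M q s k a J lam F i x
      = ∑ σ ∈ SS q s k a (k + 1), ∑ b ∈ Sσ σ, ‖r b x‖ ^ 2 := by
    intro x
    unfold gg
    rw [← Finset.sum_fiberwise_of_maps_to
      (s := SS q s k a (J - i)) (t := SS q s k a (k + 1))
      (g := fun b' => b' % q ^ ((k + 1) * s)) (fun b' hb' => SS_parent hb' (by omega))]
  calc ∑ x with p x, ∑ σ ∈ SS q s k a (k + 1), ∑ σ' ∈ SS q s k a (k + 1),
      (if σ ≠ σ' then ‖FF M q s k a J lam F i σ x * FF M q s k a J lam F i σ' x‖ ^ 2 else 0)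
      = ∑ x with p x, av H (fun x => ∑ σ ∈ SS q s k a (k + 1), ∑ σ' ∈ SS q s k a (k + 1),
        (if σ ≠ σ' then ‖FF M q s k a J lam F i σ x * FF M q s k a J lam F i σ' x‖ ^ 2 else 0)) x :=
        sum_av H p hp _
    _ ≤ ∑ x with p x, ∑ σ ∈ SS q s k a (k + 1), ∑ σ' ∈ SS q s k a (k + 1),
        (q : ℝ) ^ (2 * s) * ((∑ b ∈ Sσ σ, ‖r b x‖ ^ 2) * (∑ b ∈ Sσ σ', ‖r b x‖ ^ 2)) := by
        refine Finset.sum_le_sum fun x _ => ?_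
        rw [av_sum_comm]
        refine Finset.sum_le_sum fun σ _ => ?_
        rw [av_sum_comm]
        refine Finset.sum_le_sum fun σ' _ => ?_
        by_cases h : σ = σ'
        · simp only [h, ne_eq, not_true_eq_false, if_false]
          refine (av_le H _ 0 (fun _ => le_rfl) x).trans (by positivity)
        · simp only [ne_eq, h, not_false_eq_true, if_true]
          exact key σ σ' h x
    _ = _ := by
        rw [Finset.mul_sum]
        refine Finset.sum_congr rfl fun x _ => ?_
        rw [hgsum, sq, Finset.sum_mul_sum, Finset.mul_sum]
        refine Finset.sum_congr rfl fun σ _ => ?_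
        rw [Finset.mul_sum]

end Tree

open MeasureTheory

section MainFinite

variable {q M : ℕ}

theorem FF_step [Fact q.Prime] (s k a J : ℕ) (lam : ℝ) (hlam : 0 < lam)
    (F : ℕ → ZMod (q ^ M) × ZMod (q ^ M) → ℂ)
    (i : ℕ) (hk : k + 1 ≤ J - (i + 1)) (σ v) :
    ‖FF M q s k a J lam F i σ v - FF M q s k a J lam F (i + 1) σ v‖
      ≤ gg M q s k a J lam F i v / lam := by
  have hks : (k + 1) * s ≤ (J - (i + 1)) * s := Nat.mul_le_mul_right s hk
  have e : FF M q s k a J lam F (i + 1) σ v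
      = ∑ b' ∈ (SS q s k a (J - i)).filter (fun b => b % q ^ ((k + 1) * s) = σ),
        if ‖raw M q s k a J lam F i b' v‖ ≤ lam then raw M q s k a J lam F i b' v else 0 := by
    unfold FF
    simp only [raw]
    rw [← Finset.sum_fiberwise_of_maps_to
      (s := (SS q s k a (J - i)).filter (fun b => b % q ^ ((k + 1) * s) = σ))
      (t := (SS q s k a (J - (i + 1))).filter (fun b => b % q ^ ((k + 1) * s) = σ))
      (g := fun b' => b' % q ^ ((J - (i + 1)) * s))]
    · refine Finset.sum_congr rfl fun b hb => ?_
      refine Finset.sum_congr ?_ fun _ _ => rfl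
      ext b'
      simp only [Finset.mem_filter]
      constructor
      · rintro ⟨h1, h2⟩
        refine ⟨⟨h1, ?_⟩, h2⟩
        rw [← mod_mod_pow b' hks, h2]
        exact (Finset.mem_filter.mp hb).2
      · rintro ⟨⟨h1, _⟩, h2⟩
        exact ⟨h1, h2⟩
    · intro b' hb'
      obtain ⟨h1, h2⟩ := Finset.mem_filter.mp hb'
      exact Finset.mem_filter.mpr ⟨SS_parent h1 (by omega), by rw [mod_mod_pow b' hks, h2]⟩
  rw [e]
  unfold FF gg
  rw [← Finset.sum_sub_distrib, Finset.sum_div]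
  refine (norm_sum_le _ _).trans ?_
  refine (Finset.sum_le_sum_of_subset_of_nonneg (Finset.filter_subset _ _)
    (fun _ _ _ => norm_nonneg _)).trans ?_
  refine Finset.sum_le_sum fun b _ => ?_
  split_ifs with h
  · simp only [sub_self, norm_zero]; positivity
  · rw [sub_zero, le_div_iff₀ hlam]
    push Not at h
    nlinarith [norm_nonneg (raw M q s k a J lam F i b v)]

theorem FF_err [Fact q.Prime] (s k a J : ℕ) (lam : ℝ) (hlam : 0 < lam)
    (F : ℕ → ZMod (q ^ M) × ZMod (q ^ M) → ℂ) (B : ℝ) (σ v) :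
    ∀ i : ℕ, k + 1 ≤ J - i → (∀ j < i, gg M q s k a J lam F j v ≤ B) →
    ‖FF M q s k a J lam F 0 σ v - FF M q s k a J lam F i σ v‖ ≤ i * (B / lam) := by
  intro i
  induction i with
  | zero => intro _ _; simp
  | succ i ih =>
    intro hk hB
    have h1 := ih (by omega) (fun j hj => hB j (by omega))
    have h2 := FF_step s k a J lam hlam F i hk σ v
    have h3 : gg M q s k a J lam F i v / lam ≤ B / lam :=
      div_le_div_of_nonneg_right (hB i (by omega)) hlam.le
    have h4 := norm_sub_le_norm_sub_add_norm_sub (FF M q s k a J lam F 0 σ v)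
      (FF M q s k a J lam F i σ v) (FF M q s k a J lam F (i + 1) σ v)
    push_cast
    linarith

theorem pair_lower (x y x' y' : ℂ) (m K : ℝ) (hm : 0 < m) (hK : 1 ≤ K)
    (hxy : ‖x * y‖ = m ^ 2) (hx : ‖x‖ ≤ K * m) (hy : ‖y‖ ≤ K * m)
    (ex : ‖x - x'‖ ≤ m / (4 * K)) (ey : ‖y - y'‖ ≤ m / (4 * K)) :
    m ^ 2 / 2 ≤ ‖x' * y'‖ := by
  have hK0 : 0 < K := by linarith
  set δ := m / (4 * K) with hδ
  have hδ0 : 0 < δ := by positivity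
  have hδK : δ * K = m / 4 := by rw [hδ]; field_simp
  have h1 : ‖x‖ - δ ≤ ‖x'‖ := by
    have := norm_sub_norm_le x x'; linarith
  have h2 : ‖y‖ - δ ≤ ‖y'‖ := by
    have := norm_sub_norm_le y y'; linarith
  rw [norm_mul] at hxy ⊢
  have hx1 : δ ≤ ‖x‖ := by
    by_contra hc
    push Not at hc
    have : ‖x‖ * ‖y‖ ≤ δ * (K * m) := mul_le_mul hc.le hy (norm_nonneg _) hδ0.le
    nlinarith
  have hy1 : δ ≤ ‖y‖ := by
    by_contra hc
    push Not at hc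
    have : ‖x‖ * ‖y‖ ≤ (K * m) * δ := mul_le_mul hx hc.le (norm_nonneg _) (by positivity)
    nlinarith
  have h3 : (‖x‖ - δ) * (‖y‖ - δ) ≤ ‖x'‖ * ‖y'‖ :=
    mul_le_mul h1 h2 (by linarith) (norm_nonneg _)
  have h4 : δ * ‖x‖ ≤ m / 4 * m := by
    calc δ * ‖x‖ ≤ δ * (K * m) := mul_le_mul_of_nonneg_left hx hδ0.le
      _ = _ := by rw [← mul_assoc, hδK]
  have h5 : δ * ‖y‖ ≤ m / 4 * m := by
    calc δ * ‖y‖ ≤ δ * (K * m) := mul_le_mul_of_nonneg_left hy hδ0.le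
      _ = _ := by rw [← mul_assoc, hδK]
  nlinarith [sq_nonneg δ]

theorem FF_last [Fact q.Prime] (s k a J : ℕ) (lam : ℝ)
    (F : ℕ → ZMod (q ^ M) × ZMod (q ^ M) → ℂ) (hkJ : k < J) (σ v)
    (hσ : σ ∈ SS q s k a (k + 1)) :
    FF M q s k a J lam F (J - k - 1) σ v = raw M q s k a J lam F (J - k - 1) σ v := by
  unfold FF
  have hJ : J - (J - k - 1) = k + 1 := by omega
  rw [hJ]
  have : (SS q s k a (k + 1)).filter (fun b => b % q ^ ((k + 1) * s) = σ) = {σ} := by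
    ext b
    simp only [Finset.mem_filter, Finset.mem_singleton]
    constructor
    · rintro ⟨h1, h2⟩
      rwa [Nat.mod_eq_of_lt (SS_lt h1)] at h2
    · rintro rfl
      exact ⟨hσ, Nat.mod_eq_of_lt (SS_lt hσ)⟩
  rw [this, Finset.sum_singleton]

theorem pair_le_gg [Fact q.Prime] (s k a J : ℕ) (lam : ℝ)
    (F : ℕ → ZMod (q ^ M) × ZMod (q ^ M) → ℂ) (hkJ : k < J) (σ σ' v)
    (hσ : σ ∈ SS q s k a (k + 1)) (hσ' : σ' ∈ SS q s k a (k + 1)) :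
    ‖FF M q s k a J lam F (J - k - 1) σ v * FF M q s k a J lam F (J - k - 1) σ' v‖
      ≤ gg M q s k a J lam F (J - k - 1) v := by
  rw [FF_last s k a J lam F hkJ σ v hσ, FF_last s k a J lam F hkJ σ' v hσ', norm_mul]
  have hJ : J - (J - k - 1) = k + 1 := by omega
  have h : ∀ τ ∈ SS q s k a (k + 1), ‖raw M q s k a J lam F (J - k - 1) τ v‖ ^ 2
      ≤ gg M q s k a J lam F (J - k - 1) v := by
    intro τ hτ
    unfold gg
    rw [hJ]
    exact Finset.single_le_sum (f := fun τ => ‖raw M q s k a J lam F (J - k - 1) τ v‖ ^ 2)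
      (fun _ _ => by positivity) hτ
  nlinarith [h σ hσ, h σ' hσ', sq_nonneg (‖raw M q s k a J lam F (J - k - 1) σ v‖
    - ‖raw M q s k a J lam F (J - k - 1) σ' v‖)]

set_option maxHeartbeats 1000000 in
/-- One dyadic level. -/
theorem level_est [Fact q.Prime] (hq2 : q ≠ 2) (s k a J : ℕ) (hkJ : k < J)
    (F : ℕ → ZMod (q ^ M) × ZMod (q ^ M) → ℂ)
    (ψ : AddChar (ZMod (q ^ M)) ℂ) (hψ : ψ ((q : ZMod (q ^ M)) ^ (M - 1)) ≠ 1)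
    (hF : ∀ b ∈ SS q s k a J, Eqv ψ b (J * s) (F b)) (hM : 2 * (J * s) ≤ M)
    (W K : ℝ) (hK : 1 ≤ K) (hW : 0 < W)
    (hWF : ∀ v, ∑ b ∈ SS q s k a J, ‖F b v‖ ^ 2 ≤ W)
    (X : Finset (ZMod (q ^ M) × ZMod (q ^ M))) (m : ZMod (q ^ M) × ZMod (q ^ M) → ℝ)
    (α : ℝ) (hα : 0 < α) (hXα : ∀ x ∈ X, α ≤ m x ∧ m x ≤ 2 * α)
    (hX : ∀ x ∈ X, ∃ σ ∈ SS q s k a (k + 1), ∃ σ' ∈ SS q s k a (k + 1), σ ≠ σ' ∧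
      ‖FF M q s k a J 0 F 0 σ x * FF M q s k a J 0 F 0 σ' x‖ = m x ^ 2 ∧
      ‖FF M q s k a J 0 F 0 σ x‖ ≤ K * m x ∧ ‖FF M q s k a J 0 F 0 σ' x‖ ≤ K * m x) :
    ∑ x ∈ X, m x ^ 6 ≤ 20000 * (q : ℝ) ^ (5 * s) * (J : ℝ) ^ 5 * K ^ 2 * W ^ 2 *
      ∑ b ∈ SS q s k a J, ∑ x, ‖F b x‖ ^ 2 := by
  classical
  have hJ1 : (1 : ℝ) ≤ J := by exact_mod_cast (by omega : 1 ≤ J)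
  have hJ0 : (0 : ℝ) < J := by linarith
  set lam : ℝ := 12 * J * K * W / α with hlam
  have hK0 : 0 < K := by linarith
  have hlam0 : 0 < lam := by positivity
  set E : ℝ := ∑ b ∈ SS q s k a J, ∑ x, ‖F b x‖ ^ 2 with hE
  have hE0 : 0 ≤ E := Finset.sum_nonneg fun _ _ => Finset.sum_nonneg fun _ _ => by positivity
  set g := gg M q s k a J lam F with hg
  have hgE : ∑ x, g 0 x = E := by
    simp only [hg, gg, raw, hE, Nat.sub_zero]
    rw [Finset.sum_comm]
  have hen := energy s k a J lam F ψ hψ hF hM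
  rw [← hg, hgE] at hen
  set A : ℕ → ℝ := fun i => (1 + 1 / (J : ℝ)) ^ i with hA
  have hA3 : ∀ i ≤ J, A i ≤ 3 := by
    intro i hi
    have h1 : (1 : ℝ) ≤ 1 + 1 / (J : ℝ) := by
      have : 0 < 1 / (J : ℝ) := by positivity
      linarith
    calc A i ≤ (1 + 1 / (J : ℝ)) ^ J := pow_le_pow_right₀ h1 hi
      _ ≤ (Real.exp (1 / (J : ℝ))) ^ J := by
          refine pow_le_pow_left₀ (by linarith) ?_ J
          have := Real.add_one_le_exp (1 / (J : ℝ)); linarith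
      _ = Real.exp 1 := by
          rw [← Real.exp_nat_mul]; congr 1; field_simp
      _ ≤ 3 := by have := Real.exp_one_lt_d9; linarith
  have hFF0 : ∀ σ x, FF M q s k a J 0 F 0 σ x = FF M q s k a J lam F 0 σ x := by
    intro σ x; simp only [FF, raw]
  have hg00 : ∀ x, g 0 x ≤ A 0 * W := by
    intro x
    simp only [hg, gg, raw, hA, Nat.sub_zero, pow_zero, one_mul]
    exact hWF x
  -- the pointwise lower bound
  have hpt : ∀ i, k + 1 ≤ J - i → ∀ x ∈ X, (∀ j < i, g j x ≤ A j * W) →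
      ∃ σ ∈ SS q s k a (k + 1), ∃ σ' ∈ SS q s k a (k + 1), σ ≠ σ' ∧
        m x ^ 2 / 2 ≤ ‖FF M q s k a J lam F i σ x * FF M q s k a J lam F i σ' x‖ := by
    intro i hi x hx hlow
    obtain ⟨σ, hσ, σ', hσ', hne, h1, h2, h3⟩ := hX x hx
    refine ⟨σ, hσ, σ', hσ', hne, ?_⟩
    rw [hFF0, hFF0] at h1
    rw [hFF0] at h2 h3
    obtain ⟨hm1, hm2⟩ := hXα x hx
    have hB : ∀ j < i, g j x ≤ 3 * W := fun j hj =>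
      (hlow j hj).trans (mul_le_mul_of_nonneg_right (hA3 j (by omega)) hW.le)
    have herr : ∀ τ, ‖FF M q s k a J lam F 0 τ x - FF M q s k a J lam F i τ x‖ ≤ m x / (4 * K) := by
      intro τ
      refine (FF_err s k a J lam hlam0 F (3 * W) τ x i hi hB).trans ?_
      have hiJ : (i : ℝ) ≤ J := by exact_mod_cast (by omega : i ≤ J)
      calc (i : ℝ) * (3 * W / lam) ≤ J * (3 * W / lam) :=
            mul_le_mul_of_nonneg_right hiJ (by positivity)
        _ = α / (4 * K) := by rw [hlam]; field_simp; norm_num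
        _ ≤ m x / (4 * K) := div_le_div_of_nonneg_right hm1 (by positivity)
    exact pair_lower _ _ _ _ (m x) K (by linarith) hK h1 h2 h3 (herr σ) (herr σ')
  set I := J - k - 1 with hI
  -- Regions
  set Ω : ℕ → ZMod (q ^ M) × ZMod (q ^ M) → Prop :=
    fun i x => (∀ j < i + 1, g j x ≤ A j * W) ∧ A (i + 1) * W < g (i + 1) x with hΩ
  set Low : ZMod (q ^ M) × ZMod (q ^ M) → Prop := fun x => ∀ j < I + 1, g j x ≤ A j * W with hLow
  have hcover : ∀ x ∈ X, m x ^ 6 ≤ (if Low x then m x ^ 6 else 0)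
      + ∑ i ∈ Finset.range I, (if Ω i x then m x ^ 6 else 0) := by
    intro x hx
    have hm0 : 0 ≤ m x ^ 6 := by have := (hXα x hx).1; positivity
    by_cases hl : Low x
    · rw [if_pos hl]
      have : 0 ≤ ∑ i ∈ Finset.range I, (if Ω i x then m x ^ 6 else 0) :=
        Finset.sum_nonneg fun i _ => by split_ifs <;> simp [hm0]
      linarith
    · rw [if_neg hl, zero_add]
      have hex : ∃ j, ¬ (g j x ≤ A j * W) ∧ j < I + 1 := by
        simp only [hLow] at hl
        push Not at hl
        obtain ⟨j, h1, h2⟩ := hl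
        exact ⟨j, not_le.mpr h2, h1⟩
      obtain ⟨hn1, hn2⟩ := Nat.find_spec hex
      have hmin : ∀ j < Nat.find hex, g j x ≤ A j * W := by
        intro j hj
        have := Nat.find_min hex hj
        by_contra hc
        exact this ⟨hc, by omega⟩
      have hn0 : Nat.find hex ≠ 0 := by
        intro h0; rw [h0] at hn1; exact hn1 (hg00 x)
      obtain ⟨i, hi⟩ := Nat.exists_eq_succ_of_ne_zero hn0
      rw [hi] at hn1 hn2 hmin
      have hΩi : Ω i x := ⟨hmin, not_le.mp hn1⟩
      have := Finset.single_le_sum (f := fun i => if Ω i x then m x ^ 6 else 0)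
        (fun i _ => by split_ifs <;> simp [hm0])
        (Finset.mem_range.mpr (by omega : i < I))
      simp only [if_pos hΩi] at this
      exact this
  have hlowEst : ∑ x ∈ X, (if Low x then m x ^ 6 else 0) ≤ 72 * W ^ 2 * E := by
    have : ∀ x ∈ X, (if Low x then m x ^ 6 else 0) ≤ 72 * W ^ 2 * g I x := by
      intro x hx
      have hgI : 0 ≤ g I x := gg_nonneg s k a J lam F I x
      split_ifs with hl
      · obtain ⟨σ, hσ, σ', hσ', -, h⟩ := hpt I (by omega) x hx (fun j hj => hl j (by omega))
        have h1 := pair_le_gg s k a J lam F hkJ σ σ' x hσ hσ'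
        have h2 : m x ^ 2 ≤ 2 * g I x := by linarith
        have h3 : g I x ≤ 3 * W := (hl I (by omega)).trans
          (mul_le_mul_of_nonneg_right (hA3 I (by omega)) hW.le)
        calc m x ^ 6 = (m x ^ 2) ^ 3 := by ring
          _ ≤ (2 * g I x) ^ 3 := pow_le_pow_left₀ (by positivity) h2 3
          _ = 8 * (g I x) ^ 2 * g I x := by ring
          _ ≤ 8 * (3 * W) ^ 2 * g I x := by gcongr
          _ = _ := by ring
      · positivity
    refine (Finset.sum_le_sum this).trans ?_
    rw [← Finset.mul_sum]
    refine mul_le_mul_of_nonneg_left ?_ (by positivity)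
    refine le_trans ?_ (hen I (by omega))
    exact Finset.sum_le_sum_of_subset_of_nonneg (Finset.subset_univ _)
      fun x _ _ => gg_nonneg s k a J lam F I x
  have hΩEst : ∀ i < I, ∑ x ∈ X, (if Ω i x then m x ^ 6 else 0)
      ≤ 18432 * (q : ℝ) ^ (5 * s) * (J : ℝ) ^ 4 * K ^ 2 * W ^ 2 * E := by
    intro i hi
    set H := HH q M a (k * s) ((J - (i + 1)) * s) with hH
    have hinv : ∀ v, ∀ h ∈ H, Ω i (v + h) → Ω i v := by
      intro v h hh
      have hj : ∀ j ≤ i + 1, g j (v + h) = g j v := fun j hj =>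
        gg_inv s k a J lam F ψ hF j _ (by omega) (Nat.mul_le_mul_right s (by omega)) v h hh
      rintro ⟨h1, h2⟩
      refine ⟨fun j hj' => ?_, ?_⟩
      · rw [← hj j (by omega)]; exact h1 j hj'
      · rw [← hj (i + 1) le_rfl]; exact h2
    have hb := bil_lemma hq2 s k a J lam F ψ hψ hF hM (i + 1) (by omega) (Ω i) hinv
    have hh := high_lemma hq2 s k a J lam hlam0.le F ψ hF hM i (by omega)
    have hloww := low_lemma s k a J lam F ψ hψ hF hM i (by omega)
    rw [← hg] at hh hb hloww
    have hb' : (∑ x with Ω i x, (∑ σ ∈ SS q s k a (k + 1), ∑ σ' ∈ SS q s k a (k + 1),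
        (if σ ≠ σ' then ‖FF M q s k a J lam F (i + 1) σ x * FF M q s k a J lam F (i + 1) σ' x‖ ^ 2
          else 0))) ≤ (q : ℝ) ^ (2 * s) * ∑ x with Ω i x, (g (i + 1) x) ^ 2 := by
      convert hb
    -- g ≤ (J+1) h on Ω
    have hgh : ∑ x with Ω i x, (g (i + 1) x) ^ 2 ≤ (2 * J) ^ 2 * ∑ x, (g (i + 1) x
        - av (HH q M a (k * s) ((J - i) * s)) (g (i + 1)) x) ^ 2 := by
      rw [Finset.mul_sum]
      refine le_trans ?_ (Finset.sum_le_sum_of_subset_of_nonneg (Finset.filter_subset (Ω i) _)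
        fun x _ _ => by positivity)
      refine Finset.sum_le_sum fun x hx => ?_
      obtain ⟨h1, h2⟩ := (Finset.mem_filter.mp hx).2
      rw [← mul_pow]
      refine pow_le_pow_left₀ (gg_nonneg s k a J lam F _ x) ?_ 2
      have h3 := hloww x
      have h4 := h1 i (by omega)
      have h5 : A (i + 1) = A i * (1 + 1 / (J : ℝ)) := by simp only [hA, pow_succ]
      rw [h5] at h2
      set hval := g (i + 1) x - av (HH q M a (k * s) ((J - i) * s)) (g (i + 1)) x with hhval
      have h6 : g (i + 1) x ≤ A i * W + hval := by rw [hhval]; linarith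
      have h7 : (A i * W) * (J + 1) < J * g (i + 1) x := by
        have := mul_lt_mul_of_pos_left h2 hJ0
        have e : (J : ℝ) * (A i * (1 + 1 / (J : ℝ)) * W) = (A i * W) * (J + 1) := by
          field_simp
        linarith
      have h8 : g (i + 1) x ≤ (J + 1) * hval := by nlinarith
      have h9 : 0 ≤ g (i + 1) x := gg_nonneg s k a J lam F _ x
      have h10 : 0 ≤ hval := by
        by_contra hc
        push Not at hc
        nlinarith
      nlinarith
    have hpt2 : ∀ x ∈ X, (if Ω i x then m x ^ 6 else 0) ≤ 16 * α ^ 2 * (if Ω i x then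
        (∑ σ ∈ SS q s k a (k + 1), ∑ σ' ∈ SS q s k a (k + 1),
        (if σ ≠ σ' then ‖FF M q s k a J lam F (i + 1) σ x * FF M q s k a J lam F (i + 1) σ' x‖ ^ 2
          else 0)) else 0) := by
      intro x hx
      split_ifs with hΩx
      · obtain ⟨σ, hσ, σ', hσ', hne, h⟩ := hpt (i + 1) (by omega) x hx hΩx.1
        obtain ⟨hm1, hm2⟩ := hXα x hx
        set Z := ‖FF M q s k a J lam F (i + 1) σ x * FF M q s k a J lam F (i + 1) σ' x‖ with hZ
        have h1 : Z ^ 2 ≤ ∑ σ ∈ SS q s k a (k + 1), ∑ σ' ∈ SS q s k a (k + 1),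
            (if σ ≠ σ' then ‖FF M q s k a J lam F (i + 1) σ x
              * FF M q s k a J lam F (i + 1) σ' x‖ ^ 2 else 0) := by
          have h2 := Finset.single_le_sum (f := fun σ => ∑ σ' ∈ SS q s k a (k + 1),
            (if σ ≠ σ' then ‖FF M q s k a J lam F (i + 1) σ x
              * FF M q s k a J lam F (i + 1) σ' x‖ ^ 2 else 0))
            (fun σ _ => Finset.sum_nonneg fun σ' _ => by split_ifs <;> positivity) hσ
          have h3 := Finset.single_le_sum (f := fun σ' =>
            (if σ ≠ σ' then ‖FF M q s k a J lam F (i + 1) σ x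
              * FF M q s k a J lam F (i + 1) σ' x‖ ^ 2 else 0))
            (fun σ' _ => by split_ifs <;> positivity) hσ'
          simp only [if_pos hne] at h3
          exact h3.trans h2
        calc m x ^ 6 = m x ^ 2 * (4 * (m x ^ 2 / 2) ^ 2) := by ring
          _ ≤ (2 * α) ^ 2 * (4 * Z ^ 2) := by
              have : 0 ≤ m x := by linarith
              gcongr
          _ = 16 * α ^ 2 * Z ^ 2 := by ring
          _ ≤ _ := mul_le_mul_of_nonneg_left h1 (by positivity)
      · simp
    calc ∑ x ∈ X, (if Ω i x then m x ^ 6 else 0)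
        ≤ ∑ x ∈ X, 16 * α ^ 2 * (if Ω i x then
        (∑ σ ∈ SS q s k a (k + 1), ∑ σ' ∈ SS q s k a (k + 1),
        (if σ ≠ σ' then ‖FF M q s k a J lam F (i + 1) σ x * FF M q s k a J lam F (i + 1) σ' x‖ ^ 2
          else 0)) else 0) := Finset.sum_le_sum hpt2
      _ ≤ 16 * α ^ 2 * ∑ x with Ω i x, 
        (∑ σ ∈ SS q s k a (k + 1), ∑ σ' ∈ SS q s k a (k + 1),
        (if σ ≠ σ' then ‖FF M q s k a J lam F (i + 1) σ x * FF M q s k a J lam F (i + 1) σ' x‖ ^ 2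
          else 0)) := by
          rw [← Finset.mul_sum, Finset.sum_filter]
          refine mul_le_mul_of_nonneg_left ?_ (by positivity)
          refine Finset.sum_le_sum_of_subset_of_nonneg (Finset.subset_univ _) fun x _ _ => ?_
          split_ifs
          · exact Finset.sum_nonneg fun σ _ => Finset.sum_nonneg fun σ' _ => by
              split_ifs <;> positivity
          · exact le_rfl
      _ ≤ 16 * α ^ 2 * ((q : ℝ) ^ (2 * s) * ((2 * J) ^ 2 * ((q : ℝ) ^ s *
          (2 * ((q : ℝ) ^ s * lam) ^ 2 * E)))) := by
          refine mul_le_mul_of_nonneg_left (hb'.trans ?_) (by positivity)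
          refine mul_le_mul_of_nonneg_left (hgh.trans ?_) (by positivity)
          refine mul_le_mul_of_nonneg_left (hh.trans ?_) (by positivity)
          refine mul_le_mul_of_nonneg_left ?_ (by positivity)
          refine mul_le_mul_of_nonneg_left ?_ (by positivity)
          exact hen (i + 1) (by omega)
      _ = 128 * (q : ℝ) ^ (5 * s) * J ^ 2 * (α * lam) ^ 2 * E := by
          rw [show 5 * s = 2 * s + s + (s + s) by ring, pow_add, pow_add, pow_add]; ring
      _ = _ := by
          have : α * lam = 12 * J * K * W := by rw [hlam]; field_simp
          rw [this]; ring
  calc ∑ x ∈ X, m x ^ 6 ≤ ∑ x ∈ X, ((if Low x then m x ^ 6 else 0)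
      + ∑ i ∈ Finset.range I, (if Ω i x then m x ^ 6 else 0)) := Finset.sum_le_sum hcover
    _ = ∑ x ∈ X, (if Low x then m x ^ 6 else 0)
      + ∑ i ∈ Finset.range I, ∑ x ∈ X, (if Ω i x then m x ^ 6 else 0) := by
        rw [Finset.sum_add_distrib, Finset.sum_comm (s := X)]
    _ ≤ 72 * W ^ 2 * E + ∑ i ∈ Finset.range I,
        18432 * (q : ℝ) ^ (5 * s) * (J : ℝ) ^ 4 * K ^ 2 * W ^ 2 * E :=
        add_le_add hlowEst (Finset.sum_le_sum fun i hi => hΩEst i (Finset.mem_range.mp hi))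
    _ = 72 * (1 * 1 * 1) * (W ^ 2 * E) +
        I * 18432 * (q : ℝ) ^ (5 * s) * (J : ℝ) ^ 4 * K ^ 2 * (W ^ 2 * E) := by
        rw [Finset.sum_const, nsmul_eq_mul, Finset.card_range]; ring
    _ ≤ 72 * ((q : ℝ) ^ (5 * s) * (J : ℝ) ^ 5 * K ^ 2) * (W ^ 2 * E) +
        J * 18432 * (q : ℝ) ^ (5 * s) * (J : ℝ) ^ 4 * K ^ 2 * (W ^ 2 * E) := by
        have hq1 : (1 : ℝ) ≤ q := by exact_mod_cast (Fact.out : q.Prime).one_lt.le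
        have t1 : (1 : ℝ) ≤ (q : ℝ) ^ (5 * s) := one_le_pow₀ hq1
        have t2 : (1 : ℝ) ≤ (J : ℝ) ^ 5 := one_le_pow₀ hJ1
        have t3 : (1 : ℝ) ≤ K ^ 2 := one_le_pow₀ hK
        have t4 : (I : ℝ) ≤ J := by exact_mod_cast (by omega : I ≤ J)
        gcongr
    _ = 18504 * ((q : ℝ) ^ (5 * s) * (J : ℝ) ^ 5 * K ^ 2 * W ^ 2 * E) := by ring
    _ ≤ 20000 * ((q : ℝ) ^ (5 * s) * (J : ℝ) ^ 5 * K ^ 2 * W ^ 2 * E) := by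
        refine mul_le_mul_of_nonneg_right (by norm_num) (by positivity)
    _ = _ := by ring

end MainFinite

open MeasureTheory

section FiniteTotal

variable {q M : ℕ}

theorem FF_zero (s k a J : ℕ) (F : ℕ → ZMod (q ^ M) × ZMod (q ^ M) → ℂ) (σ x) :
    FF M q s k a J 0 F 0 σ x
      = ∑ b ∈ (SS q s k a J).filter (fun b => b % q ^ ((k + 1) * s) = σ), F b x := by
  simp [FF, raw]

theorem FF_energy [Fact q.Prime] (s k a J : ℕ) (hkJ : k < J)
    (F : ℕ → ZMod (q ^ M) × ZMod (q ^ M) → ℂ)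
    (ψ : AddChar (ZMod (q ^ M)) ℂ) (hψ : ψ ((q : ZMod (q ^ M)) ^ (M - 1)) ≠ 1)
    (hF : ∀ b ∈ SS q s k a J, Eqv ψ b (J * s) (F b)) (hM : 2 * (J * s) ≤ M) :
    ∑ x, ∑ σ ∈ SS q s k a (k + 1), ‖FF M q s k a J 0 F 0 σ x‖ ^ 2
      ≤ ∑ b ∈ SS q s k a J, ∑ x, ‖F b x‖ ^ 2 := by
  rw [Finset.sum_comm]
  have h1 : ∀ σ, ∑ x, ‖FF M q s k a J 0 F 0 σ x‖ ^ 2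
      ≤ ∑ b ∈ (SS q s k a J).filter (fun b => b % q ^ ((k + 1) * s) = σ), ∑ x, ‖F b x‖ ^ 2 := by
    intro σ
    rw [sum_av_univ (HH q M a (k * s) (J * s)), Finset.sum_comm (t := Finset.univ)]
    refine Finset.sum_le_sum fun x _ => ?_
    simp only [FF_zero]
    exact low_general s k a J ψ hψ hkJ.le hM _ (Finset.filter_subset _ _) F
      (fun b hb => hF b (Finset.mem_filter.mp hb).1) x
  refine (Finset.sum_le_sum fun σ _ => h1 σ).trans ?_
  rw [Finset.sum_fiberwise_of_maps_to]
  intro b hb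
  exact SS_parent hb (by omega)

theorem finite_main [Fact q.Prime] (hq2 : q ≠ 2) (s k a J D : ℕ) (hkJ : k < J)
    (F : ℕ → ZMod (q ^ M) × ZMod (q ^ M) → ℂ)
    (ψ : AddChar (ZMod (q ^ M)) ℂ) (hψ : ψ ((q : ZMod (q ^ M)) ^ (M - 1)) ≠ 1)
    (hF : ∀ b ∈ SS q s k a J, Eqv ψ b (J * s) (F b)) (hM : 2 * (J * s) ≤ M)
    (W K : ℝ) (hK : 1 ≤ K) (hD : q ^ (J * s) < 2 ^ D)
    (hWF : ∀ v, ∑ b ∈ SS q s k a J, ‖F b v‖ ^ 2 ≤ W)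
    (X : Finset (ZMod (q ^ M) × ZMod (q ^ M))) (m : ZMod (q ^ M) × ZMod (q ^ M) → ℝ)
    (hm0 : ∀ x ∈ X, 0 ≤ m x)
    (hX : ∀ x ∈ X, ∃ σ ∈ SS q s k a (k + 1), ∃ σ' ∈ SS q s k a (k + 1), σ ≠ σ' ∧
      ‖FF M q s k a J 0 F 0 σ x * FF M q s k a J 0 F 0 σ' x‖ = m x ^ 2 ∧
      ‖FF M q s k a J 0 F 0 σ x‖ ≤ K * m x ∧ ‖FF M q s k a J 0 F 0 σ' x‖ ≤ K * m x) :
    ∑ x ∈ X, m x ^ 6 ≤ 20000 * (D + 1) * (q : ℝ) ^ (5 * s) * (J : ℝ) ^ 5 * K ^ 2 * W ^ 2 *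
      ∑ b ∈ SS q s k a J, ∑ x, ‖F b x‖ ^ 2 := by
  classical
  have hJ1 : (1 : ℝ) ≤ J := by exact_mod_cast (by omega : 1 ≤ J)
  have hq1 : (1 : ℝ) ≤ q := by exact_mod_cast (Fact.out : q.Prime).one_le
  have hE0 : 0 ≤ ∑ b ∈ SS q s k a J, ∑ x, ‖F b x‖ ^ 2 :=
    Finset.sum_nonneg fun _ _ => Finset.sum_nonneg fun _ _ => by positivity
  have hW0 : 0 ≤ W := le_trans (Finset.sum_nonneg fun _ _ => by positivity) (hWF 0)
  have hFFb : ∀ σ x, ‖FF M q s k a J 0 F 0 σ x‖ ≤ ∑ b ∈ SS q s k a J, ‖F b x‖ := by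
    intro σ x
    rw [FF_zero]
    refine (norm_sum_le _ _).trans ?_
    exact Finset.sum_le_sum_of_subset_of_nonneg (Finset.filter_subset _ _)
      fun _ _ _ => norm_nonneg _
  have hcard : ((SS q s k a J).card : ℝ) ≤ (q : ℝ) ^ (J * s) := by
    have : (SS q s k a J).card ≤ q ^ (J * s) := by
      refine (Finset.card_filter_le _ _).trans ?_
      simp
    exact_mod_cast this
  have hmW : ∀ x ∈ X, m x ^ 2 ≤ (q : ℝ) ^ (J * s) * W := by
    intro x hx
    obtain ⟨σ, hσ, σ', hσ', hne, h1, -, -⟩ := hX x hx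
    rw [← h1, norm_mul]
    calc _ ≤ (∑ b ∈ SS q s k a J, ‖F b x‖) * (∑ b ∈ SS q s k a J, ‖F b x‖) :=
          mul_le_mul (hFFb _ _) (hFFb _ _) (norm_nonneg _)
            (Finset.sum_nonneg fun _ _ => norm_nonneg _)
      _ = (∑ b ∈ SS q s k a J, ‖F b x‖) ^ 2 := by ring
      _ ≤ (SS q s k a J).card * ∑ b ∈ SS q s k a J, ‖F b x‖ ^ 2 := sq_sum_le_card_mul_sum_sq
      _ ≤ _ := mul_le_mul hcard (hWF x) (Finset.sum_nonneg fun _ _ => by positivity) (by positivity)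
  have hmS : ∀ x ∈ X, m x ^ 2 ≤ ∑ σ ∈ SS q s k a (k + 1), ‖FF M q s k a J 0 F 0 σ x‖ ^ 2 := by
    intro x hx
    obtain ⟨σ, hσ, σ', hσ', hne, h1, -, -⟩ := hX x hx
    rw [← h1, norm_mul]
    have h : ∀ τ ∈ SS q s k a (k + 1), ‖FF M q s k a J 0 F 0 τ x‖ ^ 2 ≤
        ∑ σ ∈ SS q s k a (k + 1), ‖FF M q s k a J 0 F 0 σ x‖ ^ 2 := fun τ hτ =>
      Finset.single_le_sum (f := fun τ => ‖FF M q s k a J 0 F 0 τ x‖ ^ 2)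
        (fun _ _ => by positivity) hτ
    nlinarith [h σ hσ, h σ' hσ', sq_nonneg (‖FF M q s k a J 0 F 0 σ x‖
      - ‖FF M q s k a J 0 F 0 σ' x‖)]
  have hen := FF_energy s k a J hkJ F ψ hψ hF hM
  set E := ∑ b ∈ SS q s k a J, ∑ x, ‖F b x‖ ^ 2 with hE
  rcases hW0.eq_or_lt with hW | hW
  · have : ∀ x ∈ X, m x ^ 6 = 0 := by
      intro x hx
      have := hmW x hx
      rw [← hW, mul_zero] at this
      have h2 : m x = 0 := by nlinarith [sq_nonneg (m x)]
      simp [h2]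
    rw [Finset.sum_eq_zero this]
    positivity
  set w := Real.sqrt W with hw
  have hw0 : 0 < w := Real.sqrt_pos.mpr hW
  have hww : w ^ 2 = W := Real.sq_sqrt hW0
  have hcover : ∀ x ∈ X, m x ^ 6 ≤ W ^ 2 * m x ^ 2 + ∑ n ∈ Finset.range D,
      (if 2 ^ n * w ≤ m x ∧ m x ≤ 2 * (2 ^ n * w) then m x ^ 6 else 0) := by
    intro x hx
    have hs0 : 0 ≤ ∑ n ∈ Finset.range D,
      (if 2 ^ n * w ≤ m x ∧ m x ≤ 2 * (2 ^ n * w) then m x ^ 6 else 0) :=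
      Finset.sum_nonneg fun n _ => by
        split_ifs
        · have := hm0 x hx; positivity
        · exact le_rfl
    rcases le_total (m x) w with h | h
    · have h4 : m x ^ 4 ≤ w ^ 4 := pow_le_pow_left₀ (hm0 x hx) h 4
      have : w ^ 4 = W ^ 2 := by rw [← hww]; ring
      rw [this] at h4
      nlinarith [sq_nonneg (m x)]
    · have hy : 1 ≤ m x / w := by rwa [one_le_div hw0]
      obtain ⟨n, hn1, hn2⟩ := exists_nat_pow_near hy (by norm_num : (1 : ℝ) < 2)
      rw [le_div_iff₀ hw0] at hn1
      rw [div_lt_iff₀ hw0] at hn2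
      have hnD : n < D := by
        have h1 : (2 ^ n * w) ^ 2 ≤ (q : ℝ) ^ (J * s) * W :=
          (pow_le_pow_left₀ (by positivity) hn1 2).trans (hmW x hx)
        rw [mul_pow, hww] at h1
        have h2 := le_of_mul_le_mul_right h1 hW
        have h3 : (2 : ℝ) ^ n ≤ (2 ^ n) ^ 2 := by
          have : (1 : ℝ) ≤ 2 ^ n := one_le_pow₀ (by norm_num)
          nlinarith
        have h4 : (q : ℝ) ^ (J * s) < 2 ^ D := by exact_mod_cast hD
        exact (pow_lt_pow_iff_right₀ (by norm_num : (1 : ℝ) < 2)).mp (by linarith)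
      have h5 := Finset.single_le_sum (f := fun n =>
        (if 2 ^ n * w ≤ m x ∧ m x ≤ 2 * (2 ^ n * w) then m x ^ 6 else 0))
        (fun n _ => by
          split_ifs
          · have := hm0 x hx; positivity
          · exact le_rfl) (Finset.mem_range.mpr hnD)
      have hc : 2 ^ n * w ≤ m x ∧ m x ≤ 2 * (2 ^ n * w) := ⟨hn1, by rw [pow_succ] at hn2; linarith⟩
      simp only [if_pos hc] at h5
      have : 0 ≤ W ^ 2 * m x ^ 2 := by positivity
      linarith
  have hlev : ∀ n, ∑ x ∈ X, (if 2 ^ n * w ≤ m x ∧ m x ≤ 2 * (2 ^ n * w) then m x ^ 6 else 0)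
      ≤ 20000 * (q : ℝ) ^ (5 * s) * (J : ℝ) ^ 5 * K ^ 2 * W ^ 2 * E := by
    intro n
    rw [← Finset.sum_filter]
    refine level_est hq2 s k a J hkJ F ψ hψ hF hM W K hK hW hWF _ m (2 ^ n * w) (by positivity)
      (fun x hx => (Finset.mem_filter.mp hx).2) (fun x hx => hX x (Finset.mem_filter.mp hx).1)
  have hlow : ∑ x ∈ X, W ^ 2 * m x ^ 2 ≤ W ^ 2 * E := by
    rw [← Finset.mul_sum]
    refine mul_le_mul_of_nonneg_left ?_ (by positivity)
    refine (Finset.sum_le_sum hmS).trans (le_trans ?_ hen)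
    exact Finset.sum_le_sum_of_subset_of_nonneg (Finset.subset_univ _)
      fun _ _ _ => Finset.sum_nonneg fun _ _ => by positivity
  calc ∑ x ∈ X, m x ^ 6 ≤ ∑ x ∈ X, (W ^ 2 * m x ^ 2 + ∑ n ∈ Finset.range D,
      (if 2 ^ n * w ≤ m x ∧ m x ≤ 2 * (2 ^ n * w) then m x ^ 6 else 0)) :=
        Finset.sum_le_sum hcover
    _ = ∑ x ∈ X, W ^ 2 * m x ^ 2 + ∑ n ∈ Finset.range D, ∑ x ∈ X,
      (if 2 ^ n * w ≤ m x ∧ m x ≤ 2 * (2 ^ n * w) then m x ^ 6 else 0) := by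
        rw [Finset.sum_add_distrib, Finset.sum_comm (s := X)]
    _ ≤ W ^ 2 * E + ∑ n ∈ Finset.range D,
        20000 * (q : ℝ) ^ (5 * s) * (J : ℝ) ^ 5 * K ^ 2 * W ^ 2 * E :=
        add_le_add hlow (Finset.sum_le_sum fun n _ => hlev n)
    _ = 1 * (W ^ 2 * E) + D * (20000 * (q : ℝ) ^ (5 * s) * (J : ℝ) ^ 5 * K ^ 2) * (W ^ 2 * E) := by
        rw [Finset.sum_const, nsmul_eq_mul, Finset.card_range]; ring
    _ ≤ (20000 * (q : ℝ) ^ (5 * s) * (J : ℝ) ^ 5 * K ^ 2) * (W ^ 2 * E)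
        + D * (20000 * (q : ℝ) ^ (5 * s) * (J : ℝ) ^ 5 * K ^ 2) * (W ^ 2 * E) := by
        have h1 : 1 ≤ 20000 * (q : ℝ) ^ (5 * s) * (J : ℝ) ^ 5 * K ^ 2 := by
          have h2 : (1 : ℝ) ≤ (q : ℝ) ^ (5 * s) := one_le_pow₀ hq1
          have h3 : (1 : ℝ) ≤ (J : ℝ) ^ 5 := one_le_pow₀ hJ1
          have h4 : (1 : ℝ) ≤ K ^ 2 := one_le_pow₀ hK
          calc (1 : ℝ) = 1 * 1 * 1 * 1 := by norm_num
            _ ≤ _ := by gcongr; norm_num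
        gcongr
    _ = _ := by ring

end FiniteTotal

open MeasureTheory

section Grid

variable {q : ℕ} [Fact q.Prime]

theorem qR_pos (n : ℕ) : (0 : ℝ) < (q : ℝ) ^ n :=
  pow_pos (by exact_mod_cast (Fact.out : q.Prime).pos) n

theorem qQ_ne (n : ℕ) : (q : ℚ_[q]) ^ n ≠ 0 :=
  pow_ne_zero _ (by exact_mod_cast (Fact.out : q.Prime).ne_zero)

theorem norm_qpow (n : ℕ) : ‖(q : ℚ_[q]) ^ n‖ = ((q : ℝ) ^ n)⁻¹ := by
  rw [Padic.norm_p_pow, zpow_neg, zpow_natCast]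

theorem add_le_one' {x y : ℚ_[q]} (hx : ‖x‖ ≤ 1) (hy : ‖y‖ ≤ 1) : ‖x + y‖ ≤ 1 :=
  (Padic.nonarchimedean x y).trans (max_le hx hy)

theorem sub_le_one' {x y : ℚ_[q]} (hx : ‖x‖ ≤ 1) (hy : ‖y‖ ≤ 1) : ‖x - y‖ ≤ 1 := by
  rw [sub_eq_add_neg]; exact add_le_one' hx (by rwa [norm_neg])

theorem int_norm_le_iff (z : ℤ) (n : ℕ) :
    ‖(z : ℚ_[q])‖ ≤ ((q : ℝ) ^ n)⁻¹ ↔ (q : ℤ) ^ n ∣ z := by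
  rw [← Padic.norm_int_le_pow_iff_dvd, zpow_neg, zpow_natCast]

/-- the grid -/
noncomputable def io (q M : ℕ) [Fact q.Prime] (i : ZMod (q ^ M)) : ℚ_[q] :=
  (i.val : ℚ_[q]) / (q : ℚ_[q]) ^ M

theorem div_norm_le_one_iff (z : ℚ_[q]) (M : ℕ) :
    ‖z / (q : ℚ_[q]) ^ M‖ ≤ 1 ↔ ‖z‖ ≤ ((q : ℝ) ^ M)⁻¹ := by
  rw [norm_div, norm_qpow, div_le_one (inv_pos.mpr (qR_pos M))]

instance neZero_qM (M : ℕ) : NeZero (q ^ M) := ⟨pow_ne_zero _ (Fact.out : q.Prime).ne_zero⟩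

theorem io_int (M : ℕ) (z : ℤ) : ‖io q M (z : ZMod (q ^ M)) - (z : ℚ_[q]) / (q : ℚ_[q]) ^ M‖ ≤ 1 := by
  unfold io
  rw [← sub_div, div_norm_le_one_iff]
  have : (((((z : ZMod (q ^ M)).val : ℤ) - z : ℤ)) : ℚ_[q])
      = (((z : ZMod (q ^ M)).val : ℚ_[q])) - (z : ℚ_[q]) := by push_cast; ring
  rw [← this, int_norm_le_iff]
  have h : (((((z : ZMod (q ^ M)).val : ℤ) - z : ℤ)) : ZMod (q ^ M)) = 0 := by
    push_cast; simp
  rw [ZMod.intCast_zmod_eq_zero_iff_dvd] at h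
  exact_mod_cast h

theorem io_norm (M : ℕ) (i : ZMod (q ^ M)) : ‖io q M i‖ ≤ (q : ℝ) ^ M := by
  unfold io
  rw [norm_div, norm_qpow, div_inv_eq_mul]
  have := Padic.norm_int_le_one (p := q) (i.val : ℤ)
  have h2 := qR_pos (q := q) M
  push_cast at this
  nlinarith

theorem io_eq_int (M : ℕ) (i : ZMod (q ^ M)) :
    io q M i = (((i.val : ℤ)) : ℚ_[q]) / (q : ℚ_[q]) ^ M := by
  unfold io; push_cast; rfl

theorem io_add (M : ℕ) (i j : ZMod (q ^ M)) :
    ‖io q M (i + j) - (io q M i + io q M j)‖ ≤ 1 := by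
  have := io_int (q := q) M ((i.val : ℤ) + (j.val : ℤ))
  push_cast at this
  rw [ZMod.natCast_zmod_val, ZMod.natCast_zmod_val] at this
  convert this using 2
  unfold io; ring

theorem exists_io (M : ℕ) (z : ℚ_[q]) (hz : ‖z‖ ≤ (q : ℝ) ^ M) :
    ∃ i : ZMod (q ^ M), ‖z - io q M i‖ ≤ 1 := by
  have h1 : ‖z * (q : ℚ_[q]) ^ M‖ ≤ 1 := by
    rw [norm_mul, norm_qpow, ← div_eq_mul_inv, div_le_one (qR_pos M)]; exact hz
  let y : ℤ_[q] := ⟨_, h1⟩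
  refine ⟨PadicInt.toZModPow M y, ?_⟩
  have h2 : y - (((PadicInt.toZModPow M y).val : ℕ) : ℤ_[q]) ∈ RingHom.ker (PadicInt.toZModPow (p := q) M) := by
    rw [RingHom.mem_ker, map_sub, map_natCast, ZMod.natCast_zmod_val, sub_self]
  rw [PadicInt.ker_toZModPow, ← PadicInt.norm_le_pow_iff_mem_span_pow] at h2
  have h3 : z - io q M (PadicInt.toZModPow M y)
      = (z * (q : ℚ_[q]) ^ M - ((PadicInt.toZModPow M y).val : ℚ_[q])) / (q : ℚ_[q]) ^ M := by
    unfold io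
    rw [sub_div, mul_div_cancel_right₀ _ (qQ_ne M)]
  rw [h3, div_norm_le_one_iff]
  rw [zpow_neg, zpow_natCast, PadicInt.norm_def] at h2
  push_cast at h2
  exact h2

theorem io_unique (M : ℕ) (z : ℚ_[q]) (i j : ZMod (q ^ M)) (hi : ‖z - io q M i‖ ≤ 1)
    (hj : ‖z - io q M j‖ ≤ 1) : i = j := by
  have h := sub_le_one' hj hi
  have h3 : z - io q M j - (z - io q M i) = ((((i.val : ℤ) - (j.val : ℤ) : ℤ)) : ℚ_[q]) / (q : ℚ_[q]) ^ M := by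
    unfold io; push_cast; ring
  rw [h3, div_norm_le_one_iff, int_norm_le_iff] at h
  have h4 : ((((i.val : ℤ) - (j.val : ℤ) : ℤ)) : ZMod (q ^ M)) = 0 := by
    rw [ZMod.intCast_zmod_eq_zero_iff_dvd]; exact_mod_cast h
  push_cast at h4
  rw [ZMod.natCast_zmod_val, ZMod.natCast_zmod_val] at h4
  exact sub_eq_zero.mp h4

/-- integral of a periodic function -/
theorem integral_grid (μ : Measure ℚ_[q]) [μ.IsAddHaarMeasure] [SigmaFinite μ]
    (hμ : μ {x : ℚ_[q] | ‖x‖ ≤ 1} = 1) (M : ℕ) (Φ : ℚ_[q] × ℚ_[q] → ℝ)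
    (hper : ∀ x t : ℚ_[q] × ℚ_[q], ‖t.1‖ ≤ 1 → ‖t.2‖ ≤ 1 → Φ (x + t) = Φ x)
    (hz : ∀ x : ℚ_[q] × ℚ_[q], ¬ (‖x.1‖ ≤ (q : ℝ) ^ M ∧ ‖x.2‖ ≤ (q : ℝ) ^ M) → Φ x = 0) :
    ∫ x, Φ x ∂(μ.prod μ) = ∑ v : ZMod (q ^ M) × ZMod (q ^ M), Φ (io q M v.1, io q M v.2) := by
  let B : ZMod (q ^ M) × ZMod (q ^ M) → Set (ℚ_[q] × ℚ_[q]) := fun v =>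
    {x | ‖x - io q M v.1‖ ≤ 1} ×ˢ {x | ‖x - io q M v.2‖ ≤ 1}
  have hms : ∀ c : ℚ_[q], MeasurableSet {x : ℚ_[q] | ‖x - c‖ ≤ 1} := fun c =>
    (isClosed_le (by fun_prop) (by fun_prop)).measurableSet
  have hB : ∀ v, MeasurableSet (B v) := fun v => (hms _).prod (hms _)
  have hball : ∀ c : ℚ_[q], μ {x : ℚ_[q] | ‖x - c‖ ≤ 1} = 1 := by
    intro c
    rw [← hμ, ← measure_preimage_add_right μ (-c) {x : ℚ_[q] | ‖x‖ ≤ 1}]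
    simp [sub_eq_add_neg]
  have hμB : ∀ v, (μ.prod μ) (B v) = 1 := fun v => by
    rw [Measure.prod_prod, hball, hball, one_mul]
  have hΦ : Φ = fun x => ∑ v, (B v).indicator (fun _ => Φ (io q M v.1, io q M v.2)) x := by
    funext x
    by_cases hx : ‖x.1‖ ≤ (q : ℝ) ^ M ∧ ‖x.2‖ ≤ (q : ℝ) ^ M
    · obtain ⟨i, hi⟩ := exists_io M x.1 hx.1
      obtain ⟨j, hj⟩ := exists_io M x.2 hx.2
      rw [Finset.sum_eq_single (i, j)]
      · rw [Set.indicator_of_mem (show x ∈ B (i, j) from ⟨hi, hj⟩)]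
        have := hper (io q M i, io q M j) (x.1 - io q M i, x.2 - io q M j) hi hj
        rw [← this]
        congr 1
        ext <;> simp
      · intro v _ hv
        refine Set.indicator_of_notMem (fun hmem => hv ?_) _
        obtain ⟨h1, h2⟩ := hmem
        exact Prod.ext (io_unique M _ _ _ h1 hi) (io_unique M _ _ _ h2 hj)
      · simp
    · rw [hz x hx, Finset.sum_eq_zero]
      intro v _
      refine Set.indicator_of_notMem (fun hmem => hx ?_) _
      obtain ⟨h1, h2⟩ := hmem
      have h1q : (1 : ℝ) ≤ (q : ℝ) ^ M := one_le_pow₀ (by exact_mod_cast (Fact.out : q.Prime).one_le)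
      constructor
      · have := Padic.nonarchimedean (x.1 - io q M v.1) (io q M v.1)
        rw [sub_add_cancel] at this
        exact this.trans (max_le (le_trans h1 h1q) (io_norm M _))
      · have := Padic.nonarchimedean (x.2 - io q M v.2) (io q M v.2)
        rw [sub_add_cancel] at this
        exact this.trans (max_le (le_trans h2 h1q) (io_norm M _))
  conv_lhs => rw [hΦ]
  rw [integral_finsetSum]
  · refine Finset.sum_congr rfl fun v _ => ?_
    rw [integral_indicator_const _ (hB v), measureReal_def, hμB]
    simp
  · intro v _
    refine (integrable_indicator_iff (hB v)).mpr ?_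
    exact integrableOn_const (by rw [hμB]; simp)

end Grid

open MeasureTheory

section Proj

variable {q : ℕ} [Fact q.Prime]

theorem mem_qpItv {ℓ a : ℕ} {ξ : ℚ_[q]} :
    ξ ∈ qpItv q ℓ a ↔ ‖ξ - (a : ℚ_[q])‖ ≤ ((q : ℝ) ^ ℓ)⁻¹ := by
  unfold qpItv
  rw [Set.mem_setOf_eq, zpow_neg, zpow_natCast]

theorem nat_mem_qpItv {ℓ a b : ℕ} :
    (b : ℚ_[q]) ∈ qpItv q ℓ a ↔ b % q ^ ℓ = a % q ^ ℓ := by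
  rw [mem_qpItv]
  have : (b : ℚ_[q]) - (a : ℚ_[q]) = (((b : ℤ) - (a : ℤ) : ℤ) : ℚ_[q]) := by push_cast; rfl
  rw [this, int_norm_le_iff]
  have h := Nat.modEq_iff_dvd (n := q ^ ℓ) (a := a) (b := b)
  push_cast at h
  rw [← h]
  exact ⟨fun h => h.symm, fun h => Nat.ModEq.symm h⟩

theorem qpSubItv_eq (s k a j : ℕ) : qpSubItv q (j * s) (k * s) a = SS q s k a j := by
  unfold qpSubItv SS
  ext b
  simp only [Finset.mem_filter, nat_mem_qpItv]

theorem qpItv_measurable (ℓ a : ℕ) : MeasurableSet (qpItv q ℓ a) :=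
  (isClosed_le (by fun_prop) (by fun_prop)).measurableSet

theorem add_le_inv {x y : ℚ_[q]} {c : ℝ} (hx : ‖x‖ ≤ c) (hy : ‖y‖ ≤ c) : ‖x + y‖ ≤ c :=
  (Padic.nonarchimedean x y).trans (max_le hx hy)

theorem sub_le_inv {x y : ℚ_[q]} {c : ℝ} (hx : ‖x‖ ≤ c) (hy : ‖y‖ ≤ c) : ‖x - y‖ ≤ c := by
  rw [sub_eq_add_neg]; exact add_le_inv hx (by rwa [norm_neg])

theorem inv_qpow_anti {m n : ℕ} (h : m ≤ n) : ((q : ℝ) ^ n)⁻¹ ≤ ((q : ℝ) ^ m)⁻¹ :=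
  inv_anti₀ (qR_pos m) (pow_le_pow_right₀ (by exact_mod_cast (Fact.out : q.Prime).one_le) h)

theorem exists_nat_itv (ℓ : ℕ) (ξ : ℚ_[q]) (h : ‖ξ‖ ≤ 1) : ∃ b < q ^ ℓ, ξ ∈ qpItv q ℓ b := by
  have h1 : ‖ξ / (q : ℚ_[q]) ^ ℓ‖ ≤ (q : ℝ) ^ ℓ := by
    rw [norm_div, norm_qpow, div_inv_eq_mul]
    have := qR_pos (q := q) ℓ
    nlinarith
  obtain ⟨i, hi⟩ := exists_io ℓ _ h1
  refine ⟨i.val, ZMod.val_lt i, ?_⟩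
  rw [mem_qpItv]
  unfold io at hi
  rwa [← sub_div, div_norm_le_one_iff] at hi

theorem itv_norm_le_one {ℓ b : ℕ} {ξ : ℚ_[q]} (h : ξ ∈ qpItv q ℓ b) : ‖ξ‖ ≤ 1 := by
  rw [mem_qpItv] at h
  have h2 : ((q : ℝ) ^ ℓ)⁻¹ ≤ 1 := by simpa using inv_qpow_anti (q := q) (Nat.zero_le ℓ)
  have h3 := Padic.norm_int_le_one (p := q) (b : ℤ)
  push_cast at h3
  have := add_le_one' (h.trans h2) h3
  simpa using this

/-- children decomposition -/
theorem qpItv_children {ℓ ℓ' a : ℕ} (h : ℓ ≤ ℓ') :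
    qpItv q ℓ a = ⋃ b ∈ (Finset.range (q ^ ℓ')).filter (fun b => b % q ^ ℓ = a % q ^ ℓ),
      qpItv q ℓ' b := by
  ext ξ
  simp only [Set.mem_iUnion, Finset.mem_filter, Finset.mem_range, exists_prop]
  constructor
  · intro hξ
    obtain ⟨b, hb, hb2⟩ := exists_nat_itv ℓ' ξ (itv_norm_le_one hξ)
    refine ⟨b, ⟨hb, ?_⟩, hb2⟩
    rw [← nat_mem_qpItv (q := q)]
    rw [mem_qpItv] at hξ hb2 ⊢
    have := sub_le_inv hξ (hb2.trans (inv_qpow_anti h))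
    convert this using 2
    ring
  · rintro ⟨b, ⟨hb, hb1⟩, hb2⟩
    rw [← nat_mem_qpItv (q := q)] at hb1
    rw [mem_qpItv] at hb1 hb2 ⊢
    have := add_le_inv hb1 (hb2.trans (inv_qpow_anti h))
    convert this using 2
    ring

theorem qpItv_disjoint {ℓ b b' : ℕ} (hb : b < q ^ ℓ) (hb' : b' < q ^ ℓ) (hne : b ≠ b') :
    Disjoint (qpItv q ℓ b) (qpItv q ℓ b') := by
  rw [Set.disjoint_left]
  intro ξ h1 h2
  apply hne
  rw [← Nat.mod_eq_of_lt hb, ← Nat.mod_eq_of_lt hb', ← nat_mem_qpItv (q := q)]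
  rw [mem_qpItv] at h1 h2 ⊢
  have := sub_le_inv h2 h1
  convert this using 2
  ring

variable (μ : Measure ℚ_[q]) [μ.IsAddHaarMeasure] [SigmaFinite μ]
    (χ : ℚ_[q] → ℂ)
    (hχ_mul : ∀ x y : ℚ_[q], χ (x + y) = χ x * χ y)
    (hχ_norm : ∀ x : ℚ_[q], ‖χ x‖ = 1)
    (hχ_triv : ∀ x : ℚ_[q], ‖x‖ ≤ 1 → χ x = 1)
    (hχ_nontriv : ∃ x : ℚ_[q], ‖x‖ ≤ (q : ℝ) ∧ χ x ≠ 1)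

include hχ_mul hχ_triv in
theorem chi_congr {x y : ℚ_[q]} (h : ‖x - y‖ ≤ 1) : χ x = χ y := by
  have := hχ_mul (x - y) y
  rw [sub_add_cancel, hχ_triv _ h, one_mul] at this
  exact this

include hχ_mul hχ_triv in
theorem chi_cont : Continuous χ := by
  refine IsLocallyConstant.continuous ((IsLocallyConstant.iff_eventually_eq χ).mpr fun x => ?_)
  filter_upwards [Metric.ball_mem_nhds x one_pos] with y hy
  exact chi_congr χ hχ_mul hχ_triv (by rw [← dist_eq_norm]; exact (Metric.mem_ball.mp hy).le)

include hχ_mul hχ_triv in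
theorem fourier_per (f : ℚ_[q] × ℚ_[q] → ℂ) (M : ℕ)
    (hf : ∀ x, f x ≠ 0 → ‖x.1‖ ≤ (q : ℝ) ^ M ∧ ‖x.2‖ ≤ (q : ℝ) ^ M)
    (ξ p : ℚ_[q] × ℚ_[q]) (h1 : ‖p.1‖ ≤ ((q : ℝ) ^ M)⁻¹) (h2 : ‖p.2‖ ≤ ((q : ℝ) ^ M)⁻¹) :
    qpFourier q μ χ f (ξ + p) = qpFourier q μ χ f ξ := by
  unfold qpFourier
  congr 1
  funext x
  by_cases hx : f x = 0
  · simp [hx]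
  obtain ⟨hx1, hx2⟩ := hf x hx
  congr 1
  have hM := qR_pos (q := q) M
  have key : ∀ a b : ℚ_[q], ‖a‖ ≤ ((q : ℝ) ^ M)⁻¹ → ‖b‖ ≤ (q : ℝ) ^ M → ‖a * b‖ ≤ 1 := by
    intro a b ha hb
    rw [norm_mul]
    calc ‖a‖ * ‖b‖ ≤ ((q : ℝ) ^ M)⁻¹ * (q : ℝ) ^ M :=
          mul_le_mul ha hb (norm_nonneg _) (by positivity)
      _ = 1 := inv_mul_cancel₀ hM.ne'
  refine chi_congr χ hχ_mul hχ_triv ?_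
  have : -((ξ + p).1 * x.1 + (ξ + p).2 * x.2) - -(ξ.1 * x.1 + ξ.2 * x.2)
      = -(p.1 * x.1 + p.2 * x.2) := by simp only [Prod.fst_add, Prod.snd_add]; ring
  rw [this, norm_neg]
  exact add_le_one' (key _ _ h1 hx1) (key _ _ h2 hx2)

/-- hypotheses on the Fourier transform -/
structure GH (q : ℕ) [Fact q.Prime] (M L : ℕ) (G : ℚ_[q] × ℚ_[q] → ℂ) : Prop where
  per : ∀ ξ p : ℚ_[q] × ℚ_[q], ‖p.1‖ ≤ ((q : ℝ) ^ M)⁻¹ → ‖p.2‖ ≤ ((q : ℝ) ^ M)⁻¹ → G (ξ + p) = G ξ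
  supp : ∀ p : ℚ_[q] × ℚ_[q], G p ≠ 0 → ‖p.1‖ ≤ 1 ∧ ‖p.2 - p.1 ^ 2‖ ≤ ((q : ℝ) ^ (2 * L))⁻¹

theorem GH.cont {M L : ℕ} {G : ℚ_[q] × ℚ_[q] → ℂ} (h : GH q M L G) : Continuous G := by
  refine IsLocallyConstant.continuous ((IsLocallyConstant.iff_eventually_eq G).mpr fun x => ?_)
  filter_upwards [Metric.ball_mem_nhds x (inv_pos.mpr (qR_pos (q := q) M))] with y hy
  rw [Metric.mem_ball, dist_eq_norm] at hy
  have := h.per x (y - x) ((norm_fst_le _).trans hy.le) ((norm_snd_le _).trans hy.le)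
  rw [← this]; simp

theorem GH.compact {M L : ℕ} {G : ℚ_[q] × ℚ_[q] → ℂ} (h : GH q M L G) : HasCompactSupport G := by
  refine HasCompactSupport.intro (isCompact_closedBall (0 : ℚ_[q] × ℚ_[q]) 1) fun x hx => ?_
  by_contra hG
  obtain ⟨h1, h2⟩ := h.supp x hG
  apply hx
  rw [mem_closedBall_zero_iff, Prod.norm_def]
  refine max_le h1 ?_
  have h3 : ((q : ℝ) ^ (2 * L))⁻¹ ≤ 1 := by simpa using inv_qpow_anti (q := q) (Nat.zero_le (2 * L))
  have h4 : ‖x.1 ^ 2‖ ≤ 1 := by rw [norm_pow]; exact pow_le_one₀ (norm_nonneg _) h1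
  have := add_le_one' (h2.trans h3) h4
  simpa using this

include hχ_mul hχ_triv in
theorem GH.integrable {M L : ℕ} {G : ℚ_[q] × ℚ_[q] → ℂ} (h : GH q M L G) (x : ℚ_[q] × ℚ_[q]) :
    Integrable (fun ξ : ℚ_[q] × ℚ_[q] => G ξ * χ (ξ.1 * x.1 + ξ.2 * x.2)) (μ.prod μ) := by
  refine Continuous.integrable_of_hasCompactSupport ?_ ?_
  · have := chi_cont χ hχ_mul hχ_triv
    have h2 := h.cont
    fun_prop
  · exact h.compact.mul_right

/-- projection in terms of G -/
noncomputable def TG (G : ℚ_[q] × ℚ_[q] → ℂ) (τ : Set ℚ_[q]) (x : ℚ_[q] × ℚ_[q]) : ℂ :=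
  ∫ ξη in τ ×ˢ (Set.univ : Set ℚ_[q]),
    G ξη * χ (ξη.1 * x.1 + ξη.2 * x.2) ∂(μ.prod μ)

include hχ_mul hχ_triv in
theorem TG_children {M L : ℕ} {G : ℚ_[q] × ℚ_[q] → ℂ} (h : GH q M L G) (x : ℚ_[q] × ℚ_[q])
    {ℓ ℓ' a : ℕ} (hℓ : ℓ ≤ ℓ') :
    TG μ χ G (qpItv q ℓ a) x
      = ∑ b ∈ (Finset.range (q ^ ℓ')).filter (fun b => b % q ^ ℓ = a % q ^ ℓ),
        TG μ χ G (qpItv q ℓ' b) x := by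
  unfold TG
  rw [qpItv_children hℓ]
  simp only [Set.iUnion_prod_const]
  rw [integral_biUnion_finset]
  · intro b _
    exact (qpItv_measurable ℓ' b).prod MeasurableSet.univ
  · intro b hb b' hb' hne
    simp only [Finset.coe_filter, Finset.mem_range, Set.mem_setOf_eq] at hb hb'
    exact Set.Disjoint.set_prod_left (qpItv_disjoint hb.1 hb'.1 hne) _ _
  · intro b _
    exact (h.integrable μ χ hχ_mul hχ_triv x).integrableOn

include hχ_mul hχ_triv in
theorem TG_eqv {M L : ℕ} {G : ℚ_[q] × ℚ_[q] → ℂ} (h : GH q M L G) (x t : ℚ_[q] × ℚ_[q])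
    {ℓ c : ℕ} (hℓ : ℓ ≤ L) (h1 : ‖t.1 + 2 * c * t.2‖ ≤ (q : ℝ) ^ ℓ)
    (h2 : ‖t.2‖ ≤ (q : ℝ) ^ (2 * ℓ)) :
    TG μ χ G (qpItv q ℓ c) (x + t) = χ (c * t.1 + c ^ 2 * t.2) * TG μ χ G (qpItv q ℓ c) x := by
  unfold TG
  rw [← integral_const_mul]
  refine setIntegral_congr_fun ((qpItv_measurable ℓ c).prod MeasurableSet.univ) ?_
  rintro ξ ⟨hξ, -⟩
  simp only
  by_cases hG : G ξ = 0
  · simp [hG]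
  have hw := (h.supp ξ hG).2.trans (inv_qpow_anti (q := q) (by omega : 2 * ℓ ≤ 2 * L))
  rw [mem_qpItv] at hξ
  have key : ∀ (n : ℕ) (a b : ℚ_[q]), ‖a‖ ≤ ((q : ℝ) ^ n)⁻¹ → ‖b‖ ≤ (q : ℝ) ^ n → ‖a * b‖ ≤ 1 := by
    intro n a b ha hb
    have hM := qR_pos (q := q) n
    rw [norm_mul]
    calc ‖a‖ * ‖b‖ ≤ ((q : ℝ) ^ n)⁻¹ * (q : ℝ) ^ n :=
          mul_le_mul ha hb (norm_nonneg _) (by positivity)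
      _ = 1 := inv_mul_cancel₀ hM.ne'
  have h3 : ‖(ξ.1 - c) ^ 2‖ ≤ ((q : ℝ) ^ (2 * ℓ))⁻¹ := by
    rw [norm_pow, mul_comm 2 ℓ, pow_mul, ← inv_pow]
    exact pow_le_pow_left₀ (norm_nonneg _) hξ 2
  have h4 := add_le_one' (key _ _ _ hξ h1) (key _ _ _ (add_le_inv h3 hw) h2)
  have h5 : χ (ξ.1 * (x + t).1 + ξ.2 * (x + t).2)
      = χ (ξ.1 * x.1 + ξ.2 * x.2 + (c * t.1 + c ^ 2 * t.2)) := by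
    refine chi_congr χ hχ_mul hχ_triv ?_
    convert h4 using 2
    simp only [Prod.fst_add, Prod.snd_add]
    ring
  rw [h5, hχ_mul]
  ring

include hχ_mul hχ_triv in
theorem TG_per {M L : ℕ} {G : ℚ_[q] × ℚ_[q] → ℂ} (h : GH q M L G) (x t : ℚ_[q] × ℚ_[q])
    {ℓ c : ℕ} (hℓ : ℓ ≤ L) (h1 : ‖t.1‖ ≤ 1) (h2 : ‖t.2‖ ≤ 1) :
    TG μ χ G (qpItv q ℓ c) (x + t) = TG μ χ G (qpItv q ℓ c) x := by
  have hone : ∀ n : ℕ, (1 : ℝ) ≤ (q : ℝ) ^ n := fun n =>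
    one_le_pow₀ (by exact_mod_cast (Fact.out : q.Prime).one_le)
  have hmul : ∀ z : ℤ, ∀ y : ℚ_[q], ‖y‖ ≤ 1 → ‖(z : ℚ_[q]) * y‖ ≤ 1 := by
    intro z y hy
    rw [norm_mul]
    exact mul_le_one₀ (Padic.norm_int_le_one z) (norm_nonneg _) hy
  have e1 := hmul (2 * c) _ h2
  have e2 := hmul c _ h1
  have e3 := hmul (c ^ 2) _ h2
  push_cast at e1 e2 e3
  rw [TG_eqv μ χ hχ_mul hχ_triv h x t hℓ ((add_le_one' h1 e1).trans (hone _)) (h2.trans (hone _)),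
    hχ_triv _ (add_le_one' e2 e3), one_mul]

include hχ_mul hχ_triv in
theorem TG_shift {M L : ℕ} {G : ℚ_[q] × ℚ_[q] → ℂ} (h : GH q M L G) (x p : ℚ_[q] × ℚ_[q])
    {ℓ c : ℕ} (hℓ : ℓ ≤ M) (h1 : ‖p.1‖ ≤ ((q : ℝ) ^ M)⁻¹) (h2 : ‖p.2‖ ≤ ((q : ℝ) ^ M)⁻¹) :
    TG μ χ G (qpItv q ℓ c) x = χ (p.1 * x.1 + p.2 * x.2) * TG μ χ G (qpItv q ℓ c) x := by
  have hms : MeasurableSet (qpItv q ℓ c ×ˢ (Set.univ : Set ℚ_[q])) :=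
    (qpItv_measurable ℓ c).prod MeasurableSet.univ
  unfold TG
  rw [← integral_indicator hms]
  conv_lhs => rw [← integral_add_right_eq_self _ p]
  rw [← integral_const_mul]
  congr 1
  funext ξ
  have hmem : ξ + p ∈ qpItv q ℓ c ×ˢ (Set.univ : Set ℚ_[q]) ↔
      ξ ∈ qpItv q ℓ c ×ˢ (Set.univ : Set ℚ_[q]) := by
    simp only [Set.mem_prod, Set.mem_univ, and_true, mem_qpItv, Prod.fst_add]
    have h1' := h1.trans (inv_qpow_anti hℓ)
    constructor
    · intro h
      have := sub_le_inv h h1'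
      convert this using 2; ring
    · intro h
      have := add_le_inv h h1'
      convert this using 2; ring
  by_cases hm : ξ ∈ qpItv q ℓ c ×ˢ (Set.univ : Set ℚ_[q])
  · rw [Set.indicator_of_mem (hmem.mpr hm), Set.indicator_of_mem hm, h.per ξ p h1 h2]
    have : (ξ + p).1 * x.1 + (ξ + p).2 * x.2
        = (p.1 * x.1 + p.2 * x.2) + (ξ.1 * x.1 + ξ.2 * x.2) := by
      simp only [Prod.fst_add, Prod.snd_add]; ring
    rw [this, hχ_mul]; ring
  · rw [Set.indicator_of_notMem (fun h => hm (hmem.mp h)), Set.indicator_of_notMem hm, mul_zero]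

include hχ_mul hχ_triv hχ_nontriv in
theorem TG_zero {M L : ℕ} {G : ℚ_[q] × ℚ_[q] → ℂ} (h : GH q M L G) (x : ℚ_[q] × ℚ_[q])
    {ℓ c : ℕ} (hℓ : ℓ ≤ M) (hx : ¬ (‖x.1‖ ≤ (q : ℝ) ^ M ∧ ‖x.2‖ ≤ (q : ℝ) ^ M)) :
    TG μ χ G (qpItv q ℓ c) x = 0 := by
  obtain ⟨x0, hx0, hx1⟩ := hχ_nontriv
  have hM := qR_pos (q := q) M
  have hq0 : (0 : ℝ) < q := by simpa using qR_pos (q := q) 1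
  have hp : ∀ y : ℚ_[q], ¬ ‖y‖ ≤ (q : ℝ) ^ M → ‖x0 / y‖ ≤ ((q : ℝ) ^ M)⁻¹ ∧ x0 / y * y = x0 := by
    intro y hy
    rw [not_le] at hy
    have hy0 : 0 < ‖y‖ := hM.trans hy
    constructor
    · have := (Padic.norm_le_pow_iff_norm_lt_pow_add_one (x0 / y) (-(M : ℤ))).mpr ?_
      · rwa [zpow_neg, zpow_natCast] at this
      · rw [norm_div, zpow_add₀ hq0.ne', zpow_neg, zpow_natCast, zpow_one,
          div_lt_iff₀ hy0]
        calc ‖x0‖ ≤ q := hx0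
          _ = ((q : ℝ) ^ M)⁻¹ * q * (q : ℝ) ^ M := by field_simp
          _ < _ := mul_lt_mul_of_pos_left hy (by positivity)
    · exact div_mul_cancel₀ _ (norm_pos_iff.mp hy0)
  have fin : ∀ p : ℚ_[q] × ℚ_[q], ‖p.1‖ ≤ ((q : ℝ) ^ M)⁻¹ → ‖p.2‖ ≤ ((q : ℝ) ^ M)⁻¹ →
      p.1 * x.1 + p.2 * x.2 = x0 → TG μ χ G (qpItv q ℓ c) x = 0 := by
    intro p h1 h2 h3
    have := TG_shift μ χ hχ_mul hχ_triv h x p (c := c) hℓ h1 h2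
    rw [h3] at this
    have h4 : (χ x0 - 1) * TG μ χ G (qpItv q ℓ c) x = 0 := by
      rw [sub_mul, one_mul, ← this, sub_self]
    rcases mul_eq_zero.mp h4 with h5 | h5
    · exact absurd (sub_eq_zero.mp h5) hx1
    · exact h5
  rw [not_and_or] at hx
  rcases hx with hx | hx
  · obtain ⟨h1, h2⟩ := hp _ hx
    exact fin (x0 / x.1, 0) h1 (by simpa using hM.le) (by simpa using h2)
  · obtain ⟨h1, h2⟩ := hp _ hx
    exact fin (0, x0 / x.2) (by simpa using hM.le) h1 (by simpa using h2)

include hχ_mul hχ_triv hχ_norm in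
theorem TG_bdd {M L : ℕ} {G : ℚ_[q] × ℚ_[q] → ℂ} (h : GH q M L G) (τ : Set ℚ_[q])  :
    BddAbove (Set.range fun x => ‖TG μ χ G τ x‖) := by
  refine ⟨∫ ξ, ‖G ξ‖ ∂(μ.prod μ), ?_⟩
  rintro _ ⟨x, rfl⟩
  simp only
  unfold TG
  refine (norm_integral_le_integral_norm _).trans ?_
  have : ∀ ξ : ℚ_[q] × ℚ_[q], ‖G ξ * χ (ξ.1 * x.1 + ξ.2 * x.2)‖ = ‖G ξ‖ := by
    intro ξ; rw [norm_mul, hχ_norm, mul_one]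
  simp only [this]
  refine setIntegral_le_integral ?_ (Filter.Eventually.of_forall fun _ => norm_nonneg _)
  have := (h.integrable μ χ hχ_mul hχ_triv x).norm
  simpa only [this, ‹∀ ξ : ℚ_[q] × ℚ_[q], _›] using this

end Proj

open MeasureTheory

section Combine

theorem sup_attained (S : Finset ℕ) (φ : ℕ → ℝ) (h0 : ∀ b, b ∉ S → φ b = 0) :
    (∃ b, ⨆ b, φ b = φ b) ∧ ∀ b, φ b ≤ ⨆ b, φ b := by
  have hfin : (Set.range φ).Finite := by
    refine Set.Finite.subset ((S.image φ ∪ {0} : Finset ℝ).finite_toSet) ?_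
    rintro _ ⟨b, rfl⟩
    by_cases hb : b ∈ S
    · simp only [Finset.coe_union, Set.mem_union, Finset.mem_coe]
      exact Or.inl (Finset.mem_image_of_mem _ hb)
    · rw [h0 b hb]; simp
  constructor
  · obtain ⟨b, hb⟩ := (Set.range_nonempty φ).csSup_mem hfin
    exact ⟨b, hb.symm⟩
  · exact fun b => le_ciSup hfin.bddAbove b

open scoped Classical in
theorem iSup_prop_real (p : Prop) (x : ℝ) : (⨆ _ : p, x) = if p then x else 0 := by
  by_cases h : p
  · simp [h]
  · simp [h]

open scoped Classical in
theorem sup_pair (S : Finset ℕ) (h : ℕ → ℕ → ℝ) :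
    (∃ b b', (⨆ b ∈ S, ⨆ b' ∈ S, ⨆ _ : b ≠ b', h b b')
      = if (b ∈ S ∧ b' ∈ S ∧ b ≠ b') then h b b' else 0) ∧
    ∀ b b', (if (b ∈ S ∧ b' ∈ S ∧ b ≠ b') then h b b' else 0)
      ≤ ⨆ b ∈ S, ⨆ b' ∈ S, ⨆ _ : b ≠ b', h b b' := by
  have e : (⨆ b ∈ S, ⨆ b' ∈ S, ⨆ _ : b ≠ b', h b b')
      = ⨆ b, ⨆ b', if (b ∈ S ∧ b' ∈ S ∧ b ≠ b') then h b b' else 0 := by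
    congr 1
    funext b
    rw [iSup_prop_real]
    split_ifs with hb
    · congr 1
      funext b'
      rw [iSup_prop_real, iSup_prop_real]
      by_cases hb' : b' ∈ S <;> simp [hb, hb']
    · simp [hb]
  rw [e]
  have h1 := fun b => sup_attained S (fun b' => if (b ∈ S ∧ b' ∈ S ∧ b ≠ b') then h b b' else 0)
    (fun b' hb' => by simp [hb'])
  have h2 := sup_attained S (fun b => ⨆ b', if (b ∈ S ∧ b' ∈ S ∧ b ≠ b') then h b b' else 0)
    (fun b hb => by simp [hb])
  constructor
  · obtain ⟨b, hb⟩ := h2.1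
    obtain ⟨b', hb'⟩ := (h1 b).1
    exact ⟨b, b', hb.trans hb'⟩
  · intro b b'
    exact ((h1 b).2 b').trans (h2.2 b)

variable {q : ℕ} [Fact q.Prime]

variable (μ : Measure ℚ_[q]) [μ.IsAddHaarMeasure] [SigmaFinite μ]
    (hμ : μ {x : ℚ_[q] | ‖x‖ ≤ 1} = 1)
    (χ : ℚ_[q] → ℂ)
    (hχ_mul : ∀ x y : ℚ_[q], χ (x + y) = χ x * χ y)
    (hχ_norm : ∀ x : ℚ_[q], ‖χ x‖ = 1)
    (hχ_triv : ∀ x : ℚ_[q], ‖x‖ ≤ 1 → χ x = 1)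
    (hχ_nontriv : ∃ x : ℚ_[q], ‖x‖ ≤ (q : ℝ) ∧ χ x ≠ 1)

/-- the character on the finite group -/
noncomputable def psi (M : ℕ) : AddChar (ZMod (q ^ M)) ℂ where
  toFun i := χ (io q M i)
  map_zero_eq_one' := by
    apply hχ_triv
    simp [io]
  map_add_eq_mul' := by
    intro i j
    rw [← hχ_mul]
    exact chi_congr χ hχ_mul hχ_triv (io_add M i j)

theorem psi_int (M : ℕ) (z : ℤ) :
    psi χ hχ_mul hχ_triv M (z : ZMod (q ^ M)) = χ ((z : ℚ_[q]) / (q : ℚ_[q]) ^ M) :=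
  chi_congr χ hχ_mul hχ_triv (io_int M z)

include hχ_nontriv in
theorem psi_ne (M : ℕ) (hM : 1 ≤ M) :
    psi χ hχ_mul hχ_triv M ((q : ZMod (q ^ M)) ^ (M - 1)) ≠ 1 := by
  intro h
  obtain ⟨x0, hx0, hx1⟩ := hχ_nontriv
  have e : ((q : ZMod (q ^ M)) ^ (M - 1)) = (((q : ℤ) ^ (M - 1) : ℤ) : ZMod (q ^ M)) := by
    push_cast; rfl
  have hq0 : (q : ℚ_[q]) ≠ 0 := by simpa using qQ_ne (q := q) 1
  rw [e, psi_int] at h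
  have e2 : ((((q : ℤ) ^ (M - 1) : ℤ)) : ℚ_[q]) / (q : ℚ_[q]) ^ M = 1 / q := by
    obtain ⟨n, rfl⟩ := Nat.exists_eq_add_of_le' hM
    push_cast
    rw [pow_succ]
    field_simp
  rw [e2] at h
  have hn : ∀ n : ℕ, χ ((n : ℚ_[q]) / q) = 1 := by
    intro n
    induction n with
    | zero => simpa using hχ_triv 0 (by simp)
    | succ n ih =>
      push_cast
      rw [add_div, hχ_mul, ih, h, one_mul]
  obtain ⟨i, hi⟩ := exists_io 1 x0 (by simpa using hx0)
  apply hx1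
  rw [chi_congr χ hχ_mul hχ_triv hi]
  have := hn i.val
  unfold io
  rwa [pow_one (q : ℚ_[q])]

theorem zmod_kill_norm (M n : ℕ) (z : ℤ) (h : (q : ZMod (q ^ M)) ^ n * (z : ZMod (q ^ M)) = 0) :
    ‖(z : ℚ_[q]) / (q : ℚ_[q]) ^ M‖ ≤ (q : ℝ) ^ n := by
  have h1 : (((q : ℤ) ^ n * z : ℤ) : ZMod (q ^ M)) = 0 := by push_cast; exact h
  rw [ZMod.intCast_zmod_eq_zero_iff_dvd] at h1
  have h2 : (q : ℤ) ^ M ∣ (q : ℤ) ^ n * z := by exact_mod_cast h1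
  rw [← int_norm_le_iff] at h2
  push_cast at h2
  rw [norm_mul, norm_qpow] at h2
  rw [norm_div, norm_qpow, div_inv_eq_mul]
  have a1 := qR_pos (q := q) M
  have a2 := qR_pos (q := q) n
  rw [inv_mul_le_iff₀ a2] at h2
  calc ‖(z : ℚ_[q])‖ * (q : ℝ) ^ M ≤ ((q : ℝ) ^ n * ((q : ℝ) ^ M)⁻¹) * (q : ℝ) ^ M :=
        mul_le_mul_of_nonneg_right h2 a1.le
    _ = _ := by field_simp

theorem TG_Eqv {M L : ℕ} {G : ℚ_[q] × ℚ_[q] → ℂ} (h : GH q M L G) (b : ℕ) :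
    Eqv (psi χ hχ_mul hχ_triv M) b L
      (fun v => TG μ χ G (qpItv q L b) (io q M v.1, io q M v.2)) := by
  intro v t ht
  have h1 : (q : ZMod (q ^ M)) ^ L * (t.1 + 2 * b * t.2) = 0 := ht.1
  have h2 : (q : ZMod (q ^ M)) ^ (2 * L) * t.2 = 0 := ht.2
  have e1 : t.1 = ((t.1.val : ℤ) : ZMod (q ^ M)) := by simp
  have e2 : t.2 = ((t.2.val : ℤ) : ZMod (q ^ M)) := by simp
  have h1' := zmod_kill_norm (q := q) M L ((t.1.val : ℤ) + 2 * b * (t.2.val : ℤ))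
    (by push_cast; simpa using h1)
  have h2' := zmod_kill_norm (q := q) M (2 * L) (t.2.val : ℤ) (by simpa using h2)
  rw [← io_eq_int] at h2'
  have key := TG_eqv μ χ hχ_mul hχ_triv h (io q M v.1, io q M v.2) (io q M t.1, io q M t.2)
    (ℓ := L) (c := b) le_rfl (by
      convert h1' using 2
      unfold io; push_cast; ring) h2'
  have key2 := TG_per μ χ hχ_mul hχ_triv h ((io q M v.1, io q M v.2) + (io q M t.1, io q M t.2))
    (io q M (v + t).1 - (io q M v.1 + io q M t.1), io q M (v + t).2 - (io q M v.2 + io q M t.2))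
    (ℓ := L) (c := b) le_rfl (io_add M _ _) (io_add M _ _)
  have e3 : (io q M v.1, io q M v.2) + (io q M t.1, io q M t.2) +
    (io q M (v + t).1 - (io q M v.1 + io q M t.1), io q M (v + t).2 - (io q M v.2 + io q M t.2))
      = (io q M (v + t).1, io q M (v + t).2) := by ext <;> simp
  rw [e3, key] at key2
  simp only
  rw [key2, chr_apply]
  congr 1
  have e4 := psi_int χ hχ_mul hχ_triv M ((b : ℤ) * (t.1.val : ℤ) + (b : ℤ) ^ 2 * (t.2.val : ℤ))
  have e5 : ((((b : ℤ) * (t.1.val : ℤ) + (b : ℤ) ^ 2 * (t.2.val : ℤ) : ℤ)) : ZMod (q ^ M))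
      = ((b : ℤ) : ZMod (q ^ M)) * t.1 + (((b : ℤ) ^ 2 : ℤ) : ZMod (q ^ M)) * t.2 := by
    push_cast; simp
  rw [← e5, e4]
  congr 1
  unfold io; push_cast; ring

end Combine

open MeasureTheory

section Combine2

variable {q : ℕ} [Fact q.Prime]

theorem analytic_main (hq2 : q ≠ 2) (μ : Measure ℚ_[q]) [μ.IsAddHaarMeasure] [SigmaFinite μ]
    (hμ : μ {x : ℚ_[q] | ‖x‖ ≤ 1} = 1)
    (χ : ℚ_[q] → ℂ)
    (hχ_mul : ∀ x y : ℚ_[q], χ (x + y) = χ x * χ y)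
    (hχ_norm : ∀ x : ℚ_[q], ‖χ x‖ = 1)
    (hχ_triv : ∀ x : ℚ_[q], ‖x‖ ≤ 1 → χ x = 1)
    (hχ_nontriv : ∃ x : ℚ_[q], ‖x‖ ≤ (q : ℝ) ∧ χ x ≠ 1)
    (M s k a J D : ℕ) (hkJ : k < J) (hM1 : 1 ≤ M) (hM : 2 * (J * s) ≤ M)
    (G : ℚ_[q] × ℚ_[q] → ℂ) (hG : GH q M (J * s) G)
    (K : ℝ) (hK : 1 ≤ K) (hD : q ^ (J * s) < 2 ^ D)
    (mp m3 : ℚ_[q] × ℚ_[q] → ℝ)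
    (hmp : ∀ x, mp x = ⨆ b ∈ SS q s k a (k + 1), ⨆ b' ∈ SS q s k a (k + 1), ⨆ _ : b ≠ b',
      Real.sqrt ‖TG μ χ G (qpItv q ((k + 1) * s) b) x * TG μ χ G (qpItv q ((k + 1) * s) b') x‖)
    (hm3 : ∀ x, m3 x = ⨆ b ∈ SS q s k a (k + 1), ⨆ b' ∈ SS q s k a (k + 1), ⨆ _ : b ≠ b',
      ‖TG μ χ G (qpItv q ((k + 1) * s) b) x * TG μ χ G (qpItv q ((k + 1) * s) b') x‖ ^ 3)
    (B : Set (ℚ_[q] × ℚ_[q]))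
    (hBper : ∀ x t : ℚ_[q] × ℚ_[q], ‖t.1‖ ≤ 1 → ‖t.2‖ ≤ 1 → x ∈ B → x + t ∈ B)
    (hB : ∀ x ∈ B, (∑ b ∈ SS q s k a (k + 1), ‖TG μ χ G (qpItv q ((k + 1) * s) b) x‖ ^ 6)
      ^ ((1 : ℝ) / 6) ≤ K * mp x) :
    ∫ x in B, m3 x ∂(μ.prod μ) ≤ 20000 * (D + 1) * (q : ℝ) ^ (5 * s) * (J : ℝ) ^ 5 * K ^ 2 *
      (∑ b ∈ SS q s k a J, (⨆ x, ‖TG μ χ G (qpItv q (J * s) b) x‖) ^ 2) ^ 2 *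
      ∑ b ∈ SS q s k a J, ∫ x, ‖TG μ χ G (qpItv q (J * s) b) x‖ ^ 2 ∂(μ.prod μ) := by
  classical
  have hk1 : (k + 1) * s ≤ J * s := Nat.mul_le_mul_right s hkJ
  have hper : ∀ ℓ ≤ J * s, ∀ b (x t : ℚ_[q] × ℚ_[q]), ‖t.1‖ ≤ 1 → ‖t.2‖ ≤ 1 →
      TG μ χ G (qpItv q ℓ b) (x + t) = TG μ χ G (qpItv q ℓ b) x := fun ℓ hℓ b x t h1 h2 =>
    TG_per μ χ hχ_mul hχ_triv hG x t hℓ h1 h2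
  have hzero : ∀ ℓ ≤ J * s, ∀ b (x : ℚ_[q] × ℚ_[q]),
      ¬ (‖x.1‖ ≤ (q : ℝ) ^ M ∧ ‖x.2‖ ≤ (q : ℝ) ^ M) → TG μ χ G (qpItv q ℓ b) x = 0 :=
    fun ℓ hℓ b x hx => TG_zero μ χ hχ_mul hχ_triv hχ_nontriv hG x (by omega) hx
  -- measurability of B
  have hBo : IsOpen B := by
    rw [Metric.isOpen_iff]
    intro x hx
    refine ⟨1, one_pos, fun y hy => ?_⟩
    rw [Metric.mem_ball, dist_eq_norm] at hy
    have := hBper x (y - x) ((norm_fst_le _).trans hy.le) ((norm_snd_le _).trans hy.le) hx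
    simpa using this
  have hBiff : ∀ x t : ℚ_[q] × ℚ_[q], ‖t.1‖ ≤ 1 → ‖t.2‖ ≤ 1 → (x + t ∈ B ↔ x ∈ B) := by
    intro x t h1 h2
    refine ⟨fun h => ?_, hBper x t h1 h2⟩
    have := hBper (x + t) (-t) (by simpa using h1) (by simpa using h2) h
    simpa using this
  -- properties of mp and m3
  have hmpA := fun x => sup_pair (SS q s k a (k + 1)) (fun b b' =>
    Real.sqrt ‖TG μ χ G (qpItv q ((k + 1) * s) b) x * TG μ χ G (qpItv q ((k + 1) * s) b') x‖)
  have hm3A := fun x => sup_pair (SS q s k a (k + 1)) (fun b b' =>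
    ‖TG μ χ G (qpItv q ((k + 1) * s) b) x * TG μ χ G (qpItv q ((k + 1) * s) b') x‖ ^ 3)
  simp only [← hmp, ← hm3] at hmpA hm3A
  have hmp0 : ∀ x, 0 ≤ mp x := by
    intro x
    obtain ⟨b, b', hb⟩ := (hmpA x).1
    rw [hb]; split_ifs
    · exact Real.sqrt_nonneg _
    · exact le_rfl
  have hm36 : ∀ x, m3 x ≤ mp x ^ 6 := by
    intro x
    obtain ⟨b, b', hb⟩ := (hm3A x).1
    rw [hb]
    have h := (hmpA x).2 b b'
    split_ifs at h ⊢
    · refine le_trans (le_of_eq ?_) (pow_le_pow_left₀ (Real.sqrt_nonneg _) h 6)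
      rw [show 6 = 2 * 3 by norm_num, pow_mul, Real.sq_sqrt (norm_nonneg _)]
    · exact pow_nonneg (hmp0 x) 6
  have hm3per : ∀ x t : ℚ_[q] × ℚ_[q], ‖t.1‖ ≤ 1 → ‖t.2‖ ≤ 1 → m3 (x + t) = m3 x := by
    intro x t h1 h2
    rw [hm3, hm3]
    simp only [fun b => hper _ hk1 b x t h1 h2]
  have hm3zero : ∀ x : ℚ_[q] × ℚ_[q],
      ¬ (‖x.1‖ ≤ (q : ℝ) ^ M ∧ ‖x.2‖ ≤ (q : ℝ) ^ M) → m3 x = 0 := by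
    intro x hx
    obtain ⟨b, b', hb⟩ := (hm3A x).1
    rw [hb, hzero _ hk1 b x hx]
    simp
  have hIntB : ∫ x in B, m3 x ∂(μ.prod μ) = ∑ v : ZMod (q ^ M) × ZMod (q ^ M),
      B.indicator m3 (io q M v.1, io q M v.2) := by
    rw [← integral_indicator hBo.measurableSet]
    refine integral_grid μ hμ M _ ?_ ?_
    · intro x t h1 h2
      by_cases hx : x ∈ B
      · rw [Set.indicator_of_mem hx, Set.indicator_of_mem ((hBiff x t h1 h2).mpr hx),
          hm3per x t h1 h2]
      · rw [Set.indicator_of_notMem hx, Set.indicator_of_notMem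
          (fun h => hx ((hBiff x t h1 h2).mp h))]
    · intro x hx
      by_cases hxB : x ∈ B
      · rw [Set.indicator_of_mem hxB, hm3zero x hx]
      · rw [Set.indicator_of_notMem hxB]
  set ι : ZMod (q ^ M) × ZMod (q ^ M) → ℚ_[q] × ℚ_[q] := fun v => (io q M v.1, io q M v.2) with hι
  have hE : ∀ b, ∫ x, ‖TG μ χ G (qpItv q (J * s) b) x‖ ^ 2 ∂(μ.prod μ)
      = ∑ v, ‖TG μ χ G (qpItv q (J * s) b) (ι v)‖ ^ 2 := by
    intro b
    refine integral_grid μ hμ M _ ?_ ?_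
    · intro x t h1 h2
      rw [hper _ le_rfl b x t h1 h2]
    · intro x hx
      rw [hzero _ le_rfl b x hx]; simp
  simp only [hE]
  let F : ℕ → ZMod (q ^ M) × ZMod (q ^ M) → ℂ := fun b v => TG μ χ G (qpItv q (J * s) b) (ι v)
  have hFF : ∀ σ ∈ SS q s k a (k + 1), ∀ v, FF M q s k a J 0 F 0 σ v
      = TG μ χ G (qpItv q ((k + 1) * s) σ) (ι v) := by
    intro σ hσ v
    rw [FF_zero, TG_children μ χ hχ_mul hχ_triv hG (ι v) hk1]
    refine Finset.sum_congr ?_ fun _ _ => rfl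
    ext b
    have hσlt := SS_lt hσ
    have hσm := SS_mod hσ
    simp only [SS, Finset.mem_filter, Nat.mod_eq_of_lt hσlt]
    constructor
    · rintro ⟨⟨h1, h2⟩, h3⟩
      exact ⟨h1, h3⟩
    · rintro ⟨h1, h3⟩
      refine ⟨⟨h1, ?_⟩, h3⟩
      rw [← mod_mod_pow b (Nat.mul_le_mul_right s (Nat.le_succ k)), h3, hσm]
  let X : Finset (ZMod (q ^ M) × ZMod (q ^ M)) :=
    Finset.univ.filter (fun v => ι v ∈ B ∧ 0 < mp (ι v))
  have hfin := finite_main hq2 s k a J D hkJ F (psi χ hχ_mul hχ_triv M)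
    (psi_ne χ hχ_mul hχ_triv hχ_nontriv M hM1)
    (fun b _ => TG_Eqv μ χ hχ_mul hχ_triv hG b) hM
    (∑ b ∈ SS q s k a J, (⨆ x, ‖TG μ χ G (qpItv q (J * s) b) x‖) ^ 2) K hK hD
    (fun v => Finset.sum_le_sum fun b _ => pow_le_pow_left₀ (norm_nonneg _)
      (le_ciSup (TG_bdd μ χ hχ_mul hχ_norm hχ_triv hG (qpItv q (J * s) b)) (ι v)) 2)
    X (fun v => mp (ι v)) (fun v _ => hmp0 _) ?_
  · rw [hIntB]
    refine le_trans ?_ hfin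
    rw [Finset.sum_filter]
    refine Finset.sum_le_sum fun v _ => ?_
    by_cases hv : ι v ∈ B
    · rw [Set.indicator_of_mem (show (io q M v.1, io q M v.2) ∈ B from hv)]
      split_ifs with h
      · exact hm36 _
      · have h0 : mp (ι v) = 0 := le_antisymm (not_lt.mp fun h' => h ⟨hv, h'⟩) (hmp0 _)
        have := hm36 (ι v)
        rw [h0] at this
        simpa using this
    · rw [Set.indicator_of_notMem (show (io q M v.1, io q M v.2) ∉ B from hv)]
      split_ifs
      · exact pow_nonneg (hmp0 _) 6
      · exact le_rfl
  · intro v hv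
    obtain ⟨hvB, hvp⟩ := (Finset.mem_filter.mp hv).2
    obtain ⟨b, b', hb⟩ := (hmpA (ι v)).1
    have hcond : b ∈ SS q s k a (k + 1) ∧ b' ∈ SS q s k a (k + 1) ∧ b ≠ b' := by
      by_contra hc
      rw [if_neg hc] at hb
      exact hvp.ne' hb
    rw [if_pos hcond] at hb
    have hle : ∀ σ ∈ SS q s k a (k + 1),
        ‖TG μ χ G (qpItv q ((k + 1) * s) σ) (ι v)‖ ≤ K * mp (ι v) := by
      intro σ hσ
      refine le_trans ?_ (hB _ hvB)
      have h1 := Finset.single_le_sum (f := fun b =>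
        ‖TG μ χ G (qpItv q ((k + 1) * s) b) (ι v)‖ ^ 6) (fun _ _ => by positivity) hσ
      calc ‖TG μ χ G (qpItv q ((k + 1) * s) σ) (ι v)‖
          = (‖TG μ χ G (qpItv q ((k + 1) * s) σ) (ι v)‖ ^ 6) ^ ((1 : ℝ) / 6) := by
            rw [← Real.rpow_natCast, ← Real.rpow_mul (norm_nonneg _)]
            norm_num
        _ ≤ _ := Real.rpow_le_rpow (by positivity) h1 (by norm_num)
    refine ⟨b, hcond.1, b', hcond.2.1, hcond.2.2, ?_, ?_, ?_⟩
    · rw [hFF b hcond.1, hFF b' hcond.2.1, hb, Real.sq_sqrt (norm_nonneg _)]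
    · rw [hFF b hcond.1]; exact hle b hcond.1
    · rw [hFF b' hcond.2.1]; exact hle b' hcond.2.1

end Combine2

open MeasureTheory

section Constants

theorem const_bound (q : ℕ) [Fact q.Prime] (hq2 : q ≠ 2) (ε : ℝ) (hε : 0 < ε)
    (A m s J : ℕ) (hA : 1 / ε ≤ (A : ℝ)) (hm : 1 ≤ m)
    (hlo : (q : ℝ) ^ ((q : ℝ) ^ ((A : ℝ) * (((2 * s : ℕ) : ℝ) - 4))) ≤ (q : ℝ) ^ (2 * m))
    (hJ : J ≤ 2 * m) :
    1 ≤ Real.log ((q : ℝ) ^ (2 * m)) ∧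
    20000 * (((q * (2 * m) : ℕ) : ℝ) + 1) * (q : ℝ) ^ (5 * s) * (J : ℝ) ^ 5 *
        (Real.log ((q : ℝ) ^ (2 * m)) * (q : ℝ) ^ s) ^ 2
      ≤ 40000 * (q : ℝ) ^ 15 * (Real.log ((q : ℝ) ^ (2 * m))) ^ ((8 : ℝ) + 7 * ε / 2) := by
  have hq3 : 3 ≤ q := by
    have := (Fact.out : q.Prime).two_le
    omega
  have hq3' : (3 : ℝ) ≤ q := by exact_mod_cast hq3
  have hq0 : (0 : ℝ) < q := by linarith
  have hlogq : 1 ≤ Real.log q := by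
    rw [Real.le_log_iff_exp_le hq0]
    have := Real.exp_one_lt_d9
    linarith
  have hm' : (1 : ℝ) ≤ m := by exact_mod_cast hm
  set l := Real.log ((q : ℝ) ^ (2 * m)) with hl
  have hml : ((2 * m : ℕ) : ℝ) ≤ l := by
    rw [hl, Real.log_pow]
    have : (0 : ℝ) ≤ ((2 * m : ℕ) : ℝ) := by positivity
    nlinarith
  have hl1 : 1 ≤ l := by
    refine le_trans ?_ hml
    push_cast; linarith
  have hl0 : 0 < l := by linarith
  refine ⟨hl1, ?_⟩
  have hJl : (J : ℝ) ≤ l := le_trans (by exact_mod_cast hJ) hml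
  have hA0 : (0 : ℝ) < A := lt_of_lt_of_le (by positivity) hA
  have hAε : 1 / (A : ℝ) ≤ ε := by
    rw [div_le_iff₀ hε] at hA
    rw [div_le_iff₀ hA0]; linarith
  have h1 : (q : ℝ) ^ ((A : ℝ) * (((2 * s : ℕ) : ℝ) - 4)) ≤ l := by
    rw [← Real.rpow_natCast (q : ℝ) (2 * m),
      Real.rpow_le_rpow_left_iff (by linarith : (1 : ℝ) < q)] at hlo
    exact hlo.trans hml
  have h2 : (q : ℝ) ^ (((2 * s : ℕ) : ℝ) - 4) ≤ l ^ ε := by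
    calc (q : ℝ) ^ (((2 * s : ℕ) : ℝ) - 4)
        = ((q : ℝ) ^ ((A : ℝ) * (((2 * s : ℕ) : ℝ) - 4))) ^ (1 / (A : ℝ)) := by
          rw [← Real.rpow_mul hq0.le]
          congr 1
          field_simp
      _ ≤ l ^ (1 / (A : ℝ)) := Real.rpow_le_rpow (by positivity) h1 (by positivity)
      _ ≤ l ^ ε := Real.rpow_le_rpow_of_exponent_le hl1 hAε
  have h3 : (q : ℝ) ^ (7 * s) ≤ (q : ℝ) ^ 14 * l ^ (7 * ε / 2) := by
    calc (q : ℝ) ^ (7 * s) = (q : ℝ) ^ 14 * ((q : ℝ) ^ (((2 * s : ℕ) : ℝ) - 4)) ^ ((7 : ℝ) / 2) := by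
          rw [← Real.rpow_mul hq0.le, ← Real.rpow_natCast, ← Real.rpow_natCast,
            ← Real.rpow_add hq0]
          congr 1
          push_cast; ring
      _ ≤ (q : ℝ) ^ 14 * (l ^ ε) ^ ((7 : ℝ) / 2) := by
          gcongr
      _ = _ := by
          rw [← Real.rpow_mul hl0.le]
          congr 2
          ring
  have h4 : (((q * (2 * m) : ℕ) : ℝ) + 1) ≤ 2 * (q * l) := by
    have : ((q * (2 * m) : ℕ) : ℝ) = q * ((2 * m : ℕ) : ℝ) := by push_cast; ring
    rw [this]
    nlinarith
  calc 20000 * (((q * (2 * m) : ℕ) : ℝ) + 1) * (q : ℝ) ^ (5 * s) * (J : ℝ) ^ 5 *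
        (l * (q : ℝ) ^ s) ^ 2
      ≤ 20000 * (2 * (q * l)) * (q : ℝ) ^ (5 * s) * l ^ 5 * (l * (q : ℝ) ^ s) ^ 2 := by
        gcongr
    _ = 40000 * q * l ^ 8 * (q : ℝ) ^ (7 * s) := by
        rw [show 7 * s = 5 * s + s + s by ring, pow_add, pow_add]; ring
    _ ≤ 40000 * q * l ^ 8 * ((q : ℝ) ^ 14 * l ^ (7 * ε / 2)) := by gcongr
    _ = _ := by
        rw [Real.rpow_add hl0, show (8 : ℝ) = ((8 : ℕ) : ℝ) by norm_num, Real.rpow_natCast]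
        push_cast
        ring

end Constants

/-- **Broad estimate (Proposition 5.4).** For `J ∈ {1,…,N}`, Schwartz `f` with Fourier support
in `Ξ_{1/R_J}`, `k < J` and an interval `τ_k` of length `R_k^{-1/2}`, the integral of
`max_{τ_{k+1} ≠ τ'_{k+1} ⊂ τ_k} |f_{τ_{k+1}} f_{τ'_{k+1}}|³` over the broad set `B_{τ_k}` is
bounded by `C (log R)^{8+7ε/2} (∑_{τ_J ⊂ τ_k} ‖f_{τ_J}‖_∞²)² (∑_{τ_J ⊂ τ_k} ∫ |f_{τ_J}|²)`. -/
theorem broad_bilinear_estimate (q : ℕ) [Fact q.Prime] (hq2 : q ≠ 2)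
    (μ : Measure ℚ_[q]) [μ.IsAddHaarMeasure] [SigmaFinite μ]
    (hμ : μ {x : ℚ_[q] | ‖x‖ ≤ 1} = 1)
    (χ : ℚ_[q] → ℂ)
    (hχ_mul : ∀ x y : ℚ_[q], χ (x + y) = χ x * χ y)
    (hχ_norm : ∀ x : ℚ_[q], ‖χ x‖ = 1)
    (hχ_triv : ∀ x : ℚ_[q], ‖x‖ ≤ 1 → χ x = 1)
    (hχ_nontriv : ∃ x : ℚ_[q], ‖x‖ ≤ (q : ℝ) ∧ χ x ≠ 1)
    (ε : ℝ) (hε : 0 < ε) (hε1 : ε < 1) :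
    ∃ C : ℝ, 0 < C ∧ ∃ R₀ : ℕ, ∀ A : ℕ, 1 / ε ≤ (A : ℝ) → (A : ℝ) ≤ 2 / ε →
      ∀ m : ℕ, R₀ ≤ q ^ (2 * m) →
      ∀ r : ℕ, 4 ∣ r →
        (q : ℝ) ^ ((q : ℝ) ^ ((A : ℝ) * ((r : ℝ) - 4))) ≤ (q : ℝ) ^ (2 * m) →
        ((q : ℝ) ^ (2 * m) : ℝ) < (q : ℝ) ^ ((q : ℝ) ^ ((A : ℝ) * (r : ℝ))) →
      ∀ N : ℕ, q ^ (N * r) ≤ q ^ (2 * m) → q ^ (2 * m) < q ^ ((N + 1) * r) →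
      ∀ J : ℕ, 1 ≤ J → J ≤ N →
      ∀ f : ℚ_[q] × ℚ_[q] → ℂ, IsLocallyConstant f → HasCompactSupport f →
      (∀ p : ℚ_[q] × ℚ_[q],
        ¬ (‖p.1‖ ≤ 1 ∧ ‖p.2 - p.1 ^ 2‖ ≤ (q : ℝ) ^ (-((J * r : ℕ) : ℤ))) →
        qpFourier q μ χ f p = 0) →
      ∀ k : ℕ, k < J → ∀ a : ℕ, a ∈ Finset.range (q ^ (k * (r / 2))) →
      ∫ x in {x : ℚ_[q] × ℚ_[q] |
            ‖qpProj q μ χ f (qpItv q (k * (r / 2)) a) x‖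
              ≤ Real.log ((q : ℝ) ^ (2 * m)) * (q : ℝ) ^ (r / 2) *
                  qpMaxPair q μ χ f ((k + 1) * (r / 2)) (k * (r / 2)) a x ∧
            (∑ b ∈ qpSubItv q ((k + 1) * (r / 2)) (k * (r / 2)) a,
                ‖qpProj q μ χ f (qpItv q ((k + 1) * (r / 2)) b) x‖ ^ 6) ^ ((1 : ℝ) / 6)
              ≤ Real.log ((q : ℝ) ^ (2 * m)) * (q : ℝ) ^ (r / 2) *
                  qpMaxPair q μ χ f ((k + 1) * (r / 2)) (k * (r / 2)) a x},
          (⨆ b ∈ qpSubItv q ((k + 1) * (r / 2)) (k * (r / 2)) a,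
              ⨆ b' ∈ qpSubItv q ((k + 1) * (r / 2)) (k * (r / 2)) a, ⨆ _ : b ≠ b',
                ‖qpProj q μ χ f (qpItv q ((k + 1) * (r / 2)) b) x *
                  qpProj q μ χ f (qpItv q ((k + 1) * (r / 2)) b') x‖ ^ 3) ∂(μ.prod μ)
        ≤ C * (Real.log ((q : ℝ) ^ (2 * m))) ^ ((8 : ℝ) + 7 * ε / 2) *
            (∑ b ∈ qpSubItv q (J * (r / 2)) (k * (r / 2)) a,
                (⨆ x, ‖qpProj q μ χ f (qpItv q (J * (r / 2)) b) x‖) ^ 2) ^ 2 *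
            ∑ b ∈ qpSubItv q (J * (r / 2)) (k * (r / 2)) a,
              ∫ x, ‖qpProj q μ χ f (qpItv q (J * (r / 2)) b) x‖ ^ 2 ∂(μ.prod μ) := by
  have hq1 : 1 < q := (Fact.out : q.Prime).one_lt
  have hq0 : (0 : ℝ) < q := by exact_mod_cast (Fact.out : q.Prime).pos
  refine ⟨40000 * (q : ℝ) ^ 15, by positivity, 2, ?_⟩
  intro A hA _ m hR r hr4 hlo _ N hN1 hN2 J hJ1 hJN f _ hfc hfs k hkJ a _
  have hm : 1 ≤ m := by
    by_contra hm
    have : m = 0 := by omega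
    subst this
    simp at hR
  obtain ⟨s, rfl⟩ : ∃ s, r = 2 * s := by
    obtain ⟨t, rfl⟩ := hr4
    exact ⟨2 * t, by ring⟩
  have hs2 : 2 * s / 2 = s := by omega
  simp only [hs2]
  have hNr : N * (2 * s) ≤ 2 * m := (Nat.pow_le_pow_iff_right hq1).mp hN1
  have hNr2 : 2 * m < (N + 1) * (2 * s) := (Nat.pow_lt_pow_iff_right hq1).mp hN2
  have hs1 : 1 ≤ s := by
    rcases Nat.eq_zero_or_pos s with h | h
    · subst h; simp at hNr2
    · exact h
  have hJN' : J * s ≤ N * s := Nat.mul_le_mul_right s hJN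
  have hNs : N ≤ N * s := Nat.le_mul_of_pos_right N hs1
  have hNr' : 2 * (N * s) ≤ 2 * m := by
    calc 2 * (N * s) = N * (2 * s) := by ring
      _ ≤ _ := hNr
  obtain ⟨hl1, hconst⟩ := const_bound q hq2 ε hε A m s J hA hm hlo (by omega)
  -- support of f
  obtain ⟨n, hn⟩ : ∃ n : ℕ, ∀ x, f x ≠ 0 → ‖x‖ ≤ (q : ℝ) ^ n := by
    obtain ⟨ρ, hρ⟩ := hfc.isCompact.isBounded.exists_norm_le
    obtain ⟨n, hn⟩ := pow_unbounded_of_one_lt ρ (by exact_mod_cast hq1 : (1 : ℝ) < q)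
    exact ⟨n, fun x hx => (hρ x (subset_tsupport f hx)).trans hn.le⟩
  set M := n + 2 * (J * s) + 1 with hM
  have hnM : (q : ℝ) ^ n ≤ (q : ℝ) ^ M :=
    pow_le_pow_right₀ (by exact_mod_cast hq1.le) (by omega)
  have hG : GH q M (J * s) (qpFourier q μ χ f) := by
    constructor
    · intro ξ p h1 h2
      exact fourier_per μ χ hχ_mul hχ_triv f M
        (fun x hx => ⟨(norm_fst_le x).trans ((hn x hx).trans hnM),
          (norm_snd_le x).trans ((hn x hx).trans hnM)⟩) ξ p h1 h2
    · intro p hp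
      by_contra hc
      apply hp
      apply hfs
      rw [zpow_neg, zpow_natCast, show J * (2 * s) = 2 * (J * s) by ring]
      exact hc
  have hD : q ^ (J * s) < 2 ^ (q * (2 * m)) := by
    calc q ^ (J * s) ≤ q ^ (2 * m) := Nat.pow_le_pow_right hq1.le (by omega)
      _ < (2 ^ q) ^ (2 * m) := Nat.pow_lt_pow_left Nat.lt_two_pow_self (by omega)
      _ = _ := by rw [← pow_mul]
  have hK : 1 ≤ Real.log ((q : ℝ) ^ (2 * m)) * (q : ℝ) ^ s := by
    have : (1 : ℝ) ≤ (q : ℝ) ^ s := one_le_pow₀ (by exact_mod_cast hq1.le)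
    nlinarith
  have hper : ∀ ℓ ≤ J * s, ∀ b (x t : ℚ_[q] × ℚ_[q]), ‖t.1‖ ≤ 1 → ‖t.2‖ ≤ 1 →
      qpProj q μ χ f (qpItv q ℓ b) (x + t) = qpProj q μ χ f (qpItv q ℓ b) x :=
    fun ℓ hℓ b x t h1 h2 => TG_per μ χ hχ_mul hχ_triv hG x t hℓ h1 h2
  have hk1 : (k + 1) * s ≤ J * s := Nat.mul_le_mul_right s hkJ
  have hk0 : k * s ≤ J * s := Nat.mul_le_mul_right s hkJ.le
  have hmain := analytic_main hq2 μ hμ χ hχ_mul hχ_norm hχ_triv hχ_nontriv M s k a J (q * (2 * m))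
    hkJ (by omega) (by omega) (qpFourier q μ χ f) hG _ hK hD
    (fun x => qpMaxPair q μ χ f ((k + 1) * s) (k * s) a x)
    (fun x => (⨆ b ∈ qpSubItv q ((k + 1) * s) (k * s) a,
              ⨆ b' ∈ qpSubItv q ((k + 1) * s) (k * s) a, ⨆ _ : b ≠ b',
                ‖qpProj q μ χ f (qpItv q ((k + 1) * s) b) x *
                  qpProj q μ χ f (qpItv q ((k + 1) * s) b') x‖ ^ 3))
    (fun x => by rw [← qpSubItv_eq]; rfl) (fun x => by rw [← qpSubItv_eq]; rfl)
    {x : ℚ_[q] × ℚ_[q] |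
            ‖qpProj q μ χ f (qpItv q (k * s) a) x‖
              ≤ Real.log ((q : ℝ) ^ (2 * m)) * (q : ℝ) ^ s *
                  qpMaxPair q μ χ f ((k + 1) * s) (k * s) a x ∧
            (∑ b ∈ qpSubItv q ((k + 1) * s) (k * s) a,
                ‖qpProj q μ χ f (qpItv q ((k + 1) * s) b) x‖ ^ 6) ^ ((1 : ℝ) / 6)
              ≤ Real.log ((q : ℝ) ^ (2 * m)) * (q : ℝ) ^ s *
                  qpMaxPair q μ χ f ((k + 1) * s) (k * s) a x} ?_ ?_
  · refine hmain.trans ?_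
    rw [← qpSubItv_eq]
    refine mul_le_mul_of_nonneg_right ?_
      (Finset.sum_nonneg fun b _ => integral_nonneg fun x => by positivity)
    exact mul_le_mul_of_nonneg_right hconst (by positivity)
  · intro x t h1 h2 hx
    have e : qpMaxPair q μ χ f ((k + 1) * s) (k * s) a (x + t)
        = qpMaxPair q μ χ f ((k + 1) * s) (k * s) a x := by
      unfold qpMaxPair
      simp only [fun b => hper _ hk1 b x t h1 h2]
    obtain ⟨hx1, hx2⟩ := hx
    refine ⟨?_, ?_⟩
    · rw [e, hper _ hk0 a x t h1 h2]; exact hx1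
    · rw [e]
      simp only [fun b => hper _ hk1 b x t h1 h2]
      exact hx2
  · intro x hx
    rw [← qpSubItv_eq]
    exact hx.2
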